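/- arXiv:1007.0571 — 14 statements merged into one kernel-verified Lean document; each statement's English description precedes it below -/
import Mathlib

section
/- Let P be an X×X row-stochastic TP2 matrix, B an X×Y row-stochastic TP2 matrix with all entries positive, and g ∈ ℝ^X a vector with nondecreasing entries. Then for every π ∈ Π(X) and every pair 1 ≤ y ≤ y' ≤ Y: if g′ B_y P′ π ≥ 0 then g′ B_{y'} P′ π ≥ 0. Equivalently, the myopic local decision a*(π,y) = argmin_{a∈{1,2}} c_a′ B_y P′ π (with g = c₁ − c₂) is nondecreasing in y, so the hyperplanes {π : g′ B_y P′ π = 0}, y = 1,…,Y, define nested half-spaces of Π(X). -/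
namespace QDSL0

/-- A probability vector on `Fin n` (element of the belief simplex Π(n)). -/
def isProbVec {n : ℕ} (π : Fin n → ℝ) : Prop :=
  (∀ i, 0 ≤ π i) ∧ ∑ i, π i = 1

/-- Row-stochastic matrix: nonnegative entries, each row sums to one. -/
def rowStochastic {m n : ℕ} (A : Matrix (Fin m) (Fin n) ℝ) : Prop :=
  (∀ i j, 0 ≤ A i j) ∧ ∀ i, ∑ j, A i j = 1

/-- Totally positive of order 2: all second-order minors are nonnegative. -/
def isTP2 {m n : ℕ} (A : Matrix (Fin m) (Fin n) ℝ) : Prop :=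
  ∀ ⦃i i' : Fin m⦄ ⦃j j' : Fin n⦄, i < i' → j < j' → A i j' * A i' j ≤ A i j * A i' j'

/-- `mlrLE q p` means `p ≥_r q` in the monotone likelihood ratio order:
`p i * q j ≤ q i * p j` for all `i < j`. -/
def mlrLE {n : ℕ} (q p : Fin n → ℝ) : Prop :=
  ∀ ⦃i j : Fin n⦄, i < j → p i * q j ≤ q i * p j

/-- Predicted belief `P′π`. -/
def predict {n : ℕ} (P : Matrix (Fin n) (Fin n) ℝ) (π : Fin n → ℝ) : Fin n → ℝ :=
  fun j => ∑ i, P i j * π i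

/-- `g′ B_y P′ π` where `B_y = diag(B_{1y},…,B_{Xy})`. -/
def scoreG {X Y : ℕ} (B : Matrix (Fin X) (Fin Y) ℝ) (P : Matrix (Fin X) (Fin X) ℝ)
    (g π : Fin X → ℝ) (y : Fin Y) : ℝ :=
  ∑ i, g i * B i y * predict P π i

/-- Myopic local decision: `(0 : Fin 2)` codes decision `a = 1` (taken when
`g′B_yP′π ≤ 0`), `(1 : Fin 2)` codes decision `a = 2`. -/
noncomputable def astar {X Y : ℕ} (B : Matrix (Fin X) (Fin Y) ℝ)
    (P : Matrix (Fin X) (Fin X) ℝ) (g π : Fin X → ℝ) (y : Fin Y) : Fin 2 :=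
  if scoreG B P g π y ≤ 0 then 0 else 1

/-- The `Y × 2` local decision matrix `M^π`, with a single `1` per row in column `a*(π,y)`. -/
noncomputable def Mdec {X Y : ℕ} (B : Matrix (Fin X) (Fin Y) ℝ)
    (P : Matrix (Fin X) (Fin X) ℝ) (g π : Fin X → ℝ) :
    Matrix (Fin Y) (Fin 2) ℝ :=
  fun y a => if a = astar B P g π y then 1 else 0

/-- The decision likelihood matrix `R^π = B M^π`. -/
noncomputable def Rdec {X Y : ℕ} (B : Matrix (Fin X) (Fin Y) ℝ)
    (P : Matrix (Fin X) (Fin X) ℝ) (g π : Fin X → ℝ) :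
    Matrix (Fin X) (Fin 2) ℝ :=
  fun i a => ∑ y, B i y * Mdec B P g π y a

/-- `σ(π,a) = 1′ R^π_a P′ π`. -/
noncomputable def sigmaSL {X Y : ℕ} (B : Matrix (Fin X) (Fin Y) ℝ)
    (P : Matrix (Fin X) (Fin X) ℝ) (g π : Fin X → ℝ) (a : Fin 2) : ℝ :=
  ∑ i, Rdec B P g π i a * predict P π i

/-- The social learning Bayesian filter `T^π(π,a) = R^π_a P′π / σ(π,a)`. -/
noncomputable def Tsl {X Y : ℕ} (B : Matrix (Fin X) (Fin Y) ℝ)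
    (P : Matrix (Fin X) (Fin X) ℝ) (g π : Fin X → ℝ) (a : Fin 2) : Fin X → ℝ :=
  fun i => Rdec B P g π i a * predict P π i / sigmaSL B P g π a

/-- `σ(π,y) = 1′ B_y P′ π`. -/
noncomputable def sigmaObs {X Y : ℕ} (B : Matrix (Fin X) (Fin Y) ℝ)
    (P : Matrix (Fin X) (Fin X) ℝ) (π : Fin X → ℝ) (y : Fin Y) : ℝ :=
  ∑ i, B i y * predict P π i

/-- The HMM (classical) filter `T(π,y) = B_y P′π / σ(π,y)`. -/
noncomputable def Thmm {X Y : ℕ} (B : Matrix (Fin X) (Fin Y) ℝ)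
    (P : Matrix (Fin X) (Fin X) ℝ) (π : Fin X → ℝ) (y : Fin Y) : Fin X → ℝ :=
  fun i => B i y * predict P π i / sigmaObs B P π y


theorem sc_predict_nonneg {X : ℕ} (P : Matrix (Fin X) (Fin X) ℝ) (π : Fin X → ℝ)
    (hP : rowStochastic P) (hπ : isProbVec π) (i : Fin X) : 0 ≤ predict P π i :=
  Finset.sum_nonneg fun k _ => mul_nonneg (hP.1 k i) (hπ.1 k)

theorem sc_predict_sum {X : ℕ} (P : Matrix (Fin X) (Fin X) ℝ) (π : Fin X → ℝ)
    (hP : rowStochastic P) (hπ : isProbVec π) : ∑ i, predict P π i = 1 := by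
  unfold predict
  rw [Finset.sum_comm]
  simp only [← Finset.sum_mul, hP.2, one_mul]
  exact hπ.2

theorem sc_sigma_pos {X Y : ℕ} (P : Matrix (Fin X) (Fin X) ℝ) (B : Matrix (Fin X) (Fin Y) ℝ)
    (π : Fin X → ℝ) (hP : rowStochastic P) (hBpos : ∀ i y, 0 < B i y)
    (hπ : isProbVec π) (y : Fin Y) : 0 < sigmaObs B P π y := by
  have h0 := sc_predict_nonneg P π hP hπ
  have h1 : 0 < ∑ i, predict P π i := by
    rw [sc_predict_sum P π hP hπ]; exact one_pos
  obtain ⟨i, hi, hpos⟩ := (Finset.sum_pos_iff_of_nonneg (fun i _ => h0 i)).1 h1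
  exact Finset.sum_pos' (fun j _ => mul_nonneg (hBpos j y).le (h0 j))
    ⟨i, hi, mul_pos (hBpos i y) hpos⟩

theorem sc_cross {X : ℕ} (g p b b' : Fin X → ℝ) (hp : ∀ i, 0 ≤ p i) (hg : Monotone g)
    (hb : ∀ i j, i < j → b' i * b j ≤ b i * b' j) :
    (∑ i, g i * b i * p i) * (∑ j, b' j * p j) ≤ (∑ i, g i * b' i * p i) * (∑ j, b j * p j) := by
  have key : 0 ≤ ∑ i, ∑ j, (g i - g j) * (b' i * b j - b i * b' j) * (p i * p j) := by
    refine Finset.sum_nonneg fun i _ => Finset.sum_nonneg fun j _ =>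
      mul_nonneg ?_ (mul_nonneg (hp i) (hp j))
    rcases lt_trichotomy i j with h | h | h
    · exact mul_nonneg_of_nonpos_of_nonpos (sub_nonpos.2 (hg h.le)) (sub_nonpos.2 (hb i j h))
    · subst h; simp
    · refine mul_nonneg (sub_nonneg.2 (hg h.le)) ?_
      linarith [hb j i h]
  have e : ∑ i, ∑ j, (g i - g j) * (b' i * b j - b i * b' j) * (p i * p j)
      = 2 * ((∑ i, g i * b' i * p i) * (∑ j, b j * p j)
        - (∑ i, g i * b i * p i) * (∑ j, b' j * p j)) := by
    have e1 : (∑ i, g i * b' i * p i) * (∑ j, b j * p j)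
        - (∑ i, g i * b i * p i) * (∑ j, b' j * p j)
        = ∑ i, ∑ j, g i * (b' i * b j - b i * b' j) * (p i * p j) := by
      rw [Finset.sum_mul_sum, Finset.sum_mul_sum, ← Finset.sum_sub_distrib]
      refine Finset.sum_congr rfl fun i _ => ?_
      rw [← Finset.sum_sub_distrib]
      exact Finset.sum_congr rfl fun j _ => by ring
    rw [e1, two_mul]
    nth_rewrite 2 [Finset.sum_comm]
    rw [← Finset.sum_add_distrib]
    refine Finset.sum_congr rfl ?_
    intro i _
    rw [← Finset.sum_add_distrib]
    exact Finset.sum_congr rfl fun j _ => by ring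
  linarith

/-- under (A1) `B` TP2, (A2) `P` TP2 and submodularity (`g = c₁ − c₂`
nondecreasing), the sign of `g′ B_y P′ π` satisfies a single-crossing condition in `y`:
the myopic local decision `a*(π,y)` is nondecreasing in `y`, so the hyperplanes
`{π : g′B_yP′π = 0}` define nested half-spaces of the simplex. -/
theorem singleCrossing_in_y {X Y : ℕ}
    (P : Matrix (Fin X) (Fin X) ℝ) (B : Matrix (Fin X) (Fin Y) ℝ) (g : Fin X → ℝ)
    (hP : rowStochastic P) (hPtp2 : isTP2 P)
    (hB : rowStochastic B) (hBtp2 : isTP2 B) (hBpos : ∀ i y, 0 < B i y)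
    (hg : Monotone g) :
    ∀ π : Fin X → ℝ, isProbVec π → ∀ y y' : Fin Y, y ≤ y' →
      (0 ≤ scoreG B P g π y → 0 ≤ scoreG B P g π y') ∧
      astar B P g π y ≤ astar B P g π y' := by
  intro π hπ y y' hy
  have s1 := sc_sigma_pos P B π hP hBpos hπ y
  have s2 := sc_sigma_pos P B π hP hBpos hπ y'
  have h : scoreG B P g π y * sigmaObs B P π y' ≤ scoreG B P g π y' * sigmaObs B P π y := by
    refine sc_cross g (predict P π) (fun i => B i y) (fun i => B i y')
      (sc_predict_nonneg P π hP hπ) hg ?_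
    intro i j hij
    rcases hy.lt_or_eq with h | h
    · exact hBtp2 hij h
    · subst h; exact le_refl _
  refine ⟨fun h0 => ?_, ?_⟩
  · exact nonneg_of_mul_nonneg_left ((mul_nonneg h0 s2.le).trans h) s1
  · unfold astar
    split_ifs with h1 h2
    · exact le_refl _
    · exact Fin.zero_le _
    · exfalso
      have := mul_pos (not_le.1 h1) s2
      have := mul_nonpos_of_nonpos_of_nonneg ‹scoreG B P g π y' ≤ 0› s1.le
      linarith
    · exact le_refl _

end QDSL0
end

section
/- Let P be an X×X row-stochastic TP2 matrix, B an X×Y row-stochastic TP2 matrix with all entries positive, and g ∈ ℝ^X a vector with nondecreasing entries. Then for every y ∈ {1,…,Y} and every π, π̄ ∈ Π(X) with π̄ ≥_r π: if g′ B_y P′ π ≥ 0 then g′ B_y P′ π̄ ≥ 0. Equivalently, the myopic local decision a*(π,y) (with g = c₁ − c₂) is monotone nondecreasing in π with respect to the MLR order: π̄ ≥_r π implies a*(π̄,y) ≥ a*(π,y). -/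
namespace QDSL1

/-- A probability vector on `Fin n` (element of the belief simplex Π(n)). -/
def isProbVec {n : ℕ} (π : Fin n → ℝ) : Prop :=
  (∀ i, 0 ≤ π i) ∧ ∑ i, π i = 1

/-- Row-stochastic matrix: nonnegative entries, each row sums to one. -/
def rowStochastic {m n : ℕ} (A : Matrix (Fin m) (Fin n) ℝ) : Prop :=
  (∀ i j, 0 ≤ A i j) ∧ ∀ i, ∑ j, A i j = 1

/-- Totally positive of order 2: all second-order minors are nonnegative. -/
def isTP2 {m n : ℕ} (A : Matrix (Fin m) (Fin n) ℝ) : Prop :=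
  ∀ ⦃i i' : Fin m⦄ ⦃j j' : Fin n⦄, i < i' → j < j' → A i j' * A i' j ≤ A i j * A i' j'

/-- `mlrLE q p` means `p ≥_r q` in the monotone likelihood ratio order:
`p i * q j ≤ q i * p j` for all `i < j`. -/
def mlrLE {n : ℕ} (q p : Fin n → ℝ) : Prop :=
  ∀ ⦃i j : Fin n⦄, i < j → p i * q j ≤ q i * p j

/-- Predicted belief `P′π`. -/
def predict {n : ℕ} (P : Matrix (Fin n) (Fin n) ℝ) (π : Fin n → ℝ) : Fin n → ℝ :=
  fun j => ∑ i, P i j * π i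

/-- `g′ B_y P′ π` where `B_y = diag(B_{1y},…,B_{Xy})`. -/
def scoreG {X Y : ℕ} (B : Matrix (Fin X) (Fin Y) ℝ) (P : Matrix (Fin X) (Fin X) ℝ)
    (g π : Fin X → ℝ) (y : Fin Y) : ℝ :=
  ∑ i, g i * B i y * predict P π i

/-- Myopic local decision: `(0 : Fin 2)` codes decision `a = 1` (taken when
`g′B_yP′π ≤ 0`), `(1 : Fin 2)` codes decision `a = 2`. -/
noncomputable def astar {X Y : ℕ} (B : Matrix (Fin X) (Fin Y) ℝ)
    (P : Matrix (Fin X) (Fin X) ℝ) (g π : Fin X → ℝ) (y : Fin Y) : Fin 2 :=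
  if scoreG B P g π y ≤ 0 then 0 else 1

/-- The `Y × 2` local decision matrix `M^π`, with a single `1` per row in column `a*(π,y)`. -/
noncomputable def Mdec {X Y : ℕ} (B : Matrix (Fin X) (Fin Y) ℝ)
    (P : Matrix (Fin X) (Fin X) ℝ) (g π : Fin X → ℝ) :
    Matrix (Fin Y) (Fin 2) ℝ :=
  fun y a => if a = astar B P g π y then 1 else 0

/-- The decision likelihood matrix `R^π = B M^π`. -/
noncomputable def Rdec {X Y : ℕ} (B : Matrix (Fin X) (Fin Y) ℝ)
    (P : Matrix (Fin X) (Fin X) ℝ) (g π : Fin X → ℝ) :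
    Matrix (Fin X) (Fin 2) ℝ :=
  fun i a => ∑ y, B i y * Mdec B P g π y a

/-- `σ(π,a) = 1′ R^π_a P′ π`. -/
noncomputable def sigmaSL {X Y : ℕ} (B : Matrix (Fin X) (Fin Y) ℝ)
    (P : Matrix (Fin X) (Fin X) ℝ) (g π : Fin X → ℝ) (a : Fin 2) : ℝ :=
  ∑ i, Rdec B P g π i a * predict P π i

/-- The social learning Bayesian filter `T^π(π,a) = R^π_a P′π / σ(π,a)`. -/
noncomputable def Tsl {X Y : ℕ} (B : Matrix (Fin X) (Fin Y) ℝ)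
    (P : Matrix (Fin X) (Fin X) ℝ) (g π : Fin X → ℝ) (a : Fin 2) : Fin X → ℝ :=
  fun i => Rdec B P g π i a * predict P π i / sigmaSL B P g π a

/-- `σ(π,y) = 1′ B_y P′ π`. -/
noncomputable def sigmaObs {X Y : ℕ} (B : Matrix (Fin X) (Fin Y) ℝ)
    (P : Matrix (Fin X) (Fin X) ℝ) (π : Fin X → ℝ) (y : Fin Y) : ℝ :=
  ∑ i, B i y * predict P π i

/-- The HMM (classical) filter `T(π,y) = B_y P′π / σ(π,y)`. -/
noncomputable def Thmm {X Y : ℕ} (B : Matrix (Fin X) (Fin Y) ℝ)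
    (P : Matrix (Fin X) (Fin X) ℝ) (π : Fin X → ℝ) (y : Fin Y) : Fin X → ℝ :=
  fun i => B i y * predict P π i / sigmaObs B P π y


lemma sum_sum_nonneg {n : ℕ} (F : Fin n → Fin n → ℝ) (h : ∀ k l, 0 ≤ F k l + F l k) :
    0 ≤ ∑ k, ∑ l, F k l := by
  have h1 : 0 ≤ ∑ k, ∑ l, (F k l + F l k) :=
    Finset.sum_nonneg fun k _ => Finset.sum_nonneg fun l _ => h k l
  have h2 : ∑ k, ∑ l, F l k = ∑ k, ∑ l, F k l := Finset.sum_comm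
  simp only [Finset.sum_add_distrib] at h1
  linarith

lemma predict_mlr {n : ℕ} (P : Matrix (Fin n) (Fin n) ℝ) (hPtp2 : isTP2 P)
    (p q : Fin n → ℝ) (h : mlrLE p q) : mlrLE (predict P p) (predict P q) := by
  intro i j hij
  have key : 0 ≤ ∑ k, ∑ l, ((P k i * p k) * (P l j * q l) - (P k i * q k) * (P l j * p l)) := by
    apply sum_sum_nonneg
    intro k l
    have e : (P k i * p k) * (P l j * q l) - (P k i * q k) * (P l j * p l)
        + ((P l i * p l) * (P k j * q k) - (P l i * q l) * (P k j * p k))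
        = (P k i * P l j - P k j * P l i) * (p k * q l - q k * p l) := by ring
    rw [e]
    rcases lt_trichotomy k l with hkl | hkl | hkl
    · exact mul_nonneg (sub_nonneg.2 (hPtp2 hkl hij)) (sub_nonneg.2 (h hkl))
    · subst hkl
      apply le_of_eq
      ring
    · have a := hPtp2 hkl hij
      have b := h hkl
      exact mul_nonneg_of_nonpos_of_nonpos (by linarith) (by linarith)
  simp only [Finset.sum_sub_distrib, ← Finset.sum_mul_sum] at key
  simp only [predict]
  linarith

lemma sigmaObs_pos {X Y : ℕ} (P : Matrix (Fin X) (Fin X) ℝ) (B : Matrix (Fin X) (Fin Y) ℝ)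
    (hP : rowStochastic P) (hBpos : ∀ i y, 0 < B i y) (p : Fin X → ℝ) (hp : isProbVec p)
    (y : Fin Y) : 0 < sigmaObs B P p y := by
  have hnn : ∀ i, 0 ≤ predict P p i := fun i =>
    Finset.sum_nonneg fun k _ => mul_nonneg (hP.1 k i) (hp.1 k)
  have hs : ∑ i, predict P p i = 1 := by
    simp only [predict]
    rw [Finset.sum_comm]
    simp only [← Finset.sum_mul, hP.2, one_mul, hp.2]
  obtain ⟨i, -, hi⟩ : ∃ i ∈ Finset.univ, 0 < predict P p i :=
    Finset.exists_lt_of_sum_lt (f := fun _ => (0 : ℝ)) (by simp [hs])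
  exact Finset.sum_pos' (fun i _ => mul_nonneg (hBpos i y).le (hnn i))
    ⟨i, Finset.mem_univ _, mul_pos (hBpos i y) hi⟩

lemma score_cross {X Y : ℕ} (P : Matrix (Fin X) (Fin X) ℝ) (B : Matrix (Fin X) (Fin Y) ℝ)
    (g : Fin X → ℝ) (hPtp2 : isTP2 P) (hBpos : ∀ i y, 0 < B i y) (hg : Monotone g)
    (p q : Fin X → ℝ) (h : mlrLE p q) (y : Fin Y) :
    scoreG B P g p y * sigmaObs B P q y ≤ scoreG B P g q y * sigmaObs B P p y := by
  have hm := predict_mlr P hPtp2 p q h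
  have key : 0 ≤ ∑ k, ∑ l, ((g k * B k y * predict P q k) * (B l y * predict P p l)
      - (g k * B k y * predict P p k) * (B l y * predict P q l)) := by
    apply sum_sum_nonneg
    intro k l
    have e : (g k * B k y * predict P q k) * (B l y * predict P p l)
        - (g k * B k y * predict P p k) * (B l y * predict P q l)
        + ((g l * B l y * predict P q l) * (B k y * predict P p k)
        - (g l * B l y * predict P p l) * (B k y * predict P q k))
        = (B k y * B l y) * ((g l - g k) *
          (predict P p k * predict P q l - predict P q k * predict P p l)) := by ring
    rw [e]
    refine mul_nonneg (mul_pos (hBpos k y) (hBpos l y)).le ?_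
    rcases lt_trichotomy k l with hkl | hkl | hkl
    · exact mul_nonneg (sub_nonneg.2 (hg hkl.le)) (sub_nonneg.2 (hm hkl))
    · subst hkl
      simp
    · have a := hg hkl.le
      have b := hm hkl
      exact mul_nonneg_of_nonpos_of_nonpos (by linarith) (by linarith)
  simp only [Finset.sum_sub_distrib, ← Finset.sum_mul_sum] at key
  simp only [scoreG, sigmaObs]
  linarith

/-- under (A1), (A2) and `g = c₁ − c₂` nondecreasing, the sign of
`g′ B_y P′ π` satisfies a single-crossing condition in `π` with respect to the MLR order:
the myopic local decision `a*(π,y)` is MLR-nondecreasing in the public belief `π`. -/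
theorem singleCrossing_in_pi {X Y : ℕ}
    (P : Matrix (Fin X) (Fin X) ℝ) (B : Matrix (Fin X) (Fin Y) ℝ) (g : Fin X → ℝ)
    (hP : rowStochastic P) (hPtp2 : isTP2 P)
    (hB : rowStochastic B) (hBtp2 : isTP2 B) (hBpos : ∀ i y, 0 < B i y)
    (hg : Monotone g) :
    ∀ y : Fin Y, ∀ π πb : Fin X → ℝ, isProbVec π → isProbVec πb →
      mlrLE π πb →   -- πb ≥_r π
      (0 ≤ scoreG B P g π y → 0 ≤ scoreG B P g πb y) ∧
      astar B P g π y ≤ astar B P g πb y := by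
  intro y p q hp hq h
  have hc := score_cross P B g hPtp2 hBpos hg p q h y
  have sp := sigmaObs_pos P B hP hBpos p hp y
  have sq := sigmaObs_pos P B hP hBpos q hq y
  constructor
  · intro h0
    have := (mul_nonneg h0 sq.le).trans hc
    exact nonneg_of_mul_nonneg_left this sp
  · unfold astar
    by_cases h1 : scoreG B P g p y ≤ 0
    · simp [h1]
    · have h2 : 0 < scoreG B P g p y := not_le.1 h1
      have h3 := (mul_pos h2 sq).trans_le hc
      have h4 : 0 < scoreG B P g q y := pos_of_mul_pos_left h3 sp.le
      simp [h1, not_le.2 h4]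

end QDSL1
end

section
/- Let P be an X×X row-stochastic TP2 matrix, B an X×Y row-stochastic TP2 matrix with all entries positive, and suppose g = c₁ − c₂ has nondecreasing entries. Then for every π ∈ Π(X) there exists y*(π) ∈ {0,1,…,Y} such that the local decision satisfies a*(π,y) = 1 for all y ≤ y*(π) and a*(π,y) = 2 for all y > y*(π). Consequently the map π ↦ M^π takes at most Y+1 distinct values on Π(X): each M^π is a 'staircase' matrix whose first y*(π) rows equal (1,0) and whose remaining rows equal (0,1), so Π(X) decomposes into at most Y+1 regions on each of which the decision-likelihood matrix R^π = B M^π is constant. -/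
namespace QDSL2

/-- A probability vector on `Fin n` (element of the belief simplex Π(n)). -/
def isProbVec {n : ℕ} (π : Fin n → ℝ) : Prop :=
  (∀ i, 0 ≤ π i) ∧ ∑ i, π i = 1

/-- Row-stochastic matrix: nonnegative entries, each row sums to one. -/
def rowStochastic {m n : ℕ} (A : Matrix (Fin m) (Fin n) ℝ) : Prop :=
  (∀ i j, 0 ≤ A i j) ∧ ∀ i, ∑ j, A i j = 1

/-- Totally positive of order 2: all second-order minors are nonnegative. -/
def isTP2 {m n : ℕ} (A : Matrix (Fin m) (Fin n) ℝ) : Prop :=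
  ∀ ⦃i i' : Fin m⦄ ⦃j j' : Fin n⦄, i < i' → j < j' → A i j' * A i' j ≤ A i j * A i' j'

/-- `mlrLE q p` means `p ≥_r q` in the monotone likelihood ratio order:
`p i * q j ≤ q i * p j` for all `i < j`. -/
def mlrLE {n : ℕ} (q p : Fin n → ℝ) : Prop :=
  ∀ ⦃i j : Fin n⦄, i < j → p i * q j ≤ q i * p j

/-- Predicted belief `P′π`. -/
def predict {n : ℕ} (P : Matrix (Fin n) (Fin n) ℝ) (π : Fin n → ℝ) : Fin n → ℝ :=
  fun j => ∑ i, P i j * π i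

/-- `g′ B_y P′ π` where `B_y = diag(B_{1y},…,B_{Xy})`. -/
def scoreG {X Y : ℕ} (B : Matrix (Fin X) (Fin Y) ℝ) (P : Matrix (Fin X) (Fin X) ℝ)
    (g π : Fin X → ℝ) (y : Fin Y) : ℝ :=
  ∑ i, g i * B i y * predict P π i

/-- Myopic local decision: `(0 : Fin 2)` codes decision `a = 1` (taken when
`g′B_yP′π ≤ 0`), `(1 : Fin 2)` codes decision `a = 2`. -/
noncomputable def astar {X Y : ℕ} (B : Matrix (Fin X) (Fin Y) ℝ)
    (P : Matrix (Fin X) (Fin X) ℝ) (g π : Fin X → ℝ) (y : Fin Y) : Fin 2 :=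
  if scoreG B P g π y ≤ 0 then 0 else 1

/-- The `Y × 2` local decision matrix `M^π`, with a single `1` per row in column `a*(π,y)`. -/
noncomputable def Mdec {X Y : ℕ} (B : Matrix (Fin X) (Fin Y) ℝ)
    (P : Matrix (Fin X) (Fin X) ℝ) (g π : Fin X → ℝ) :
    Matrix (Fin Y) (Fin 2) ℝ :=
  fun y a => if a = astar B P g π y then 1 else 0

/-- The decision likelihood matrix `R^π = B M^π`. -/
noncomputable def Rdec {X Y : ℕ} (B : Matrix (Fin X) (Fin Y) ℝ)
    (P : Matrix (Fin X) (Fin X) ℝ) (g π : Fin X → ℝ) :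
    Matrix (Fin X) (Fin 2) ℝ :=
  fun i a => ∑ y, B i y * Mdec B P g π y a

/-- `σ(π,a) = 1′ R^π_a P′ π`. -/
noncomputable def sigmaSL {X Y : ℕ} (B : Matrix (Fin X) (Fin Y) ℝ)
    (P : Matrix (Fin X) (Fin X) ℝ) (g π : Fin X → ℝ) (a : Fin 2) : ℝ :=
  ∑ i, Rdec B P g π i a * predict P π i

/-- The social learning Bayesian filter `T^π(π,a) = R^π_a P′π / σ(π,a)`. -/
noncomputable def Tsl {X Y : ℕ} (B : Matrix (Fin X) (Fin Y) ℝ)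
    (P : Matrix (Fin X) (Fin X) ℝ) (g π : Fin X → ℝ) (a : Fin 2) : Fin X → ℝ :=
  fun i => Rdec B P g π i a * predict P π i / sigmaSL B P g π a

/-- `σ(π,y) = 1′ B_y P′ π`. -/
noncomputable def sigmaObs {X Y : ℕ} (B : Matrix (Fin X) (Fin Y) ℝ)
    (P : Matrix (Fin X) (Fin X) ℝ) (π : Fin X → ℝ) (y : Fin Y) : ℝ :=
  ∑ i, B i y * predict P π i

/-- The HMM (classical) filter `T(π,y) = B_y P′π / σ(π,y)`. -/
noncomputable def Thmm {X Y : ℕ} (B : Matrix (Fin X) (Fin Y) ℝ)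
    (P : Matrix (Fin X) (Fin X) ℝ) (π : Fin X → ℝ) (y : Fin Y) : Fin X → ℝ :=
  fun i => B i y * predict P π i / sigmaObs B P π y


lemma scoreG_single_crossing {X Y : ℕ}
    (P : Matrix (Fin X) (Fin X) ℝ) (B : Matrix (Fin X) (Fin Y) ℝ) (g π : Fin X → ℝ)
    (hP : rowStochastic P) (hBtp2 : isTP2 B) (hBpos : ∀ i y, 0 < B i y)
    (hg : Monotone g) (hπ : isProbVec π) {y y' : Fin Y} (hy : y ≤ y')
    (h : scoreG B P g π y' ≤ 0) : scoreG B P g π y ≤ 0 := by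
  rcases hy.eq_or_lt with rfl | hlt
  · exact h
  have hq : ∀ i, 0 ≤ predict P π i := fun i =>
    Finset.sum_nonneg fun j _ => mul_nonneg (hP.1 j i) (hπ.1 j)
  by_cases hall : ∀ i, g i ≤ 0
  · exact Finset.sum_nonpos fun i _ =>
      mul_nonpos_of_nonpos_of_nonneg
        (mul_nonpos_of_nonpos_of_nonneg (hall i) (hBpos i y).le) (hq i)
  push Not at hall
  obtain ⟨k, hk, hmin⟩ : ∃ k, 0 < g k ∧ ∀ i, i < k → g i ≤ 0 := by
    obtain ⟨k, hk⟩ := exists_minimal_of_wellFoundedLT (fun i => 0 < g i) hall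
    refine ⟨k, hk.1, fun i hi => ?_⟩
    by_contra hc
    exact absurd (hk.2 (not_le.mp hc) hi.le) (not_le.mpr hi)
  have key : B k y' * scoreG B P g π y ≤ B k y * scoreG B P g π y' := by
    unfold scoreG
    rw [Finset.mul_sum, Finset.mul_sum]
    refine Finset.sum_le_sum fun i _ => ?_
    have h1 : g i * (B k y' * B i y) ≤ g i * (B k y * B i y') := by
      rcases lt_trichotomy i k with hik | rfl | hik
      · refine mul_le_mul_of_nonpos_left ?_ (hmin i hik)
        have := hBtp2 hik hlt
        linarith
      · rw [mul_comm (B i y')]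
      · exact mul_le_mul_of_nonneg_left (hBtp2 hik hlt) (hk.le.trans (hg hik.le))
    have := mul_le_mul_of_nonneg_right h1 (hq i)
    linarith
  have h2 : B k y * scoreG B P g π y' ≤ 0 :=
    mul_nonpos_of_nonneg_of_nonpos (hBpos k y).le h
  by_contra hc
  have := mul_pos (hBpos k y') (not_le.mp hc)
  linarith

/-- under (A1), (A2) and `g = c₁ − c₂` nondecreasing, for each belief `π`
there is a threshold `t = y*(π) ∈ {0,…,Y}` so that the local decision is `a = 1`
(coded `0`) for the observations `y` with index below `t` and `a = 2` (coded `1`)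
above; each `M^π` is the corresponding staircase matrix, hence `π ↦ M^π`
(and so `π ↦ R^π = B M^π`) takes at most `Y + 1` distinct values on the simplex. -/
theorem staircase_and_finitely_many_Mdec {X Y : ℕ}
    (P : Matrix (Fin X) (Fin X) ℝ) (B : Matrix (Fin X) (Fin Y) ℝ) (g : Fin X → ℝ)
    (hP : rowStochastic P) (hPtp2 : isTP2 P)
    (hB : rowStochastic B) (hBtp2 : isTP2 B) (hBpos : ∀ i y, 0 < B i y)
    (hg : Monotone g) :
    (∀ π : Fin X → ℝ, isProbVec π →
      ∃ t : ℕ, t ≤ Y ∧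
        (∀ y : Fin Y, astar B P g π y = if (y : ℕ) < t then 0 else 1) ∧
        (∀ (y : Fin Y) (a : Fin 2),
          Mdec B P g π y a =
            if (y : ℕ) < t then (if a = 0 then 1 else 0)
            else (if a = 1 then 1 else 0))) ∧
    (∃ S : Finset (Matrix (Fin Y) (Fin 2) ℝ), S.card ≤ Y + 1 ∧
      ∀ π : Fin X → ℝ, isProbVec π → Mdec B P g π ∈ S) := by
  classical
  have main : ∀ π : Fin X → ℝ, isProbVec π →
      ∃ t : ℕ, t ≤ Y ∧
        (∀ y : Fin Y, astar B P g π y = if (y : ℕ) < t then 0 else 1) ∧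
        (∀ (y : Fin Y) (a : Fin 2),
          Mdec B P g π y a =
            if (y : ℕ) < t then (if a = 0 then 1 else 0)
            else (if a = 1 then 1 else 0)) := by
    intro π hπ
    have hex : ∃ t : ℕ, ∀ y : Fin Y, t ≤ (y : ℕ) → 0 < scoreG B P g π y :=
      ⟨Y, fun y hy => absurd y.2 (not_lt.mpr hy)⟩
    have ha : ∀ y : Fin Y,
        astar B P g π y = if (y : ℕ) < Nat.find hex then 0 else 1 := by
      intro y
      unfold astar
      by_cases hy : (y : ℕ) < Nat.find hex
      · have hn := Nat.find_min hex hy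
        push Not at hn
        obtain ⟨y', hyy, hs⟩ := hn
        rw [if_pos hy, if_pos
          (scoreG_single_crossing P B g π hP hBtp2 hBpos hg hπ (Fin.le_def.mpr hyy) hs)]
      · have := Nat.find_spec hex y (not_lt.mp hy)
        rw [if_neg hy, if_neg (not_le.mpr this)]
    refine ⟨Nat.find hex,
      Nat.find_min' hex (fun y hy => absurd y.2 (not_lt.mpr hy)), ha, ?_⟩
    intro y a
    unfold Mdec
    rw [ha y]
    split_ifs <;> simp_all
  refine ⟨main, (Finset.range (Y + 1)).image (fun t => fun (y : Fin Y) (a : Fin 2) =>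
    if (y : ℕ) < t then (if a = 0 then (1 : ℝ) else 0) else (if a = 1 then 1 else 0)), ?_, ?_⟩
  · exact Finset.card_image_le.trans (by simp)
  · intro π hπ
    obtain ⟨t, ht, -, hM⟩ := main π hπ
    refine Finset.mem_image.mpr ⟨t, Finset.mem_range.mpr (by omega), ?_⟩
    funext y a
    exact (hM y a).symm

end QDSL2
end

section
/- Let P be an X×X row-stochastic TP2 matrix, B an X×Y row-stochastic TP2 matrix with all entries positive, and suppose g = c₁ − c₂ has nondecreasing entries. Then for every π ∈ Π(X) the Y×2 local-decision matrix M^π (which has exactly one 1 in each row, in the column a*(π,y)) is TP2, i.e., M^π_{y,a} M^π_{y',a'} ≥ M^π_{y,a'} M^π_{y',a} for all y < y' and a < a'. -/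
namespace QDSL3

/-- A probability vector on `Fin n` (element of the belief simplex Π(n)). -/
def isProbVec {n : ℕ} (π : Fin n → ℝ) : Prop :=
  (∀ i, 0 ≤ π i) ∧ ∑ i, π i = 1

/-- Row-stochastic matrix: nonnegative entries, each row sums to one. -/
def rowStochastic {m n : ℕ} (A : Matrix (Fin m) (Fin n) ℝ) : Prop :=
  (∀ i j, 0 ≤ A i j) ∧ ∀ i, ∑ j, A i j = 1

/-- Totally positive of order 2: all second-order minors are nonnegative. -/
def isTP2 {m n : ℕ} (A : Matrix (Fin m) (Fin n) ℝ) : Prop :=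
  ∀ ⦃i i' : Fin m⦄ ⦃j j' : Fin n⦄, i < i' → j < j' → A i j' * A i' j ≤ A i j * A i' j'

/-- `mlrLE q p` means `p ≥_r q` in the monotone likelihood ratio order:
`p i * q j ≤ q i * p j` for all `i < j`. -/
def mlrLE {n : ℕ} (q p : Fin n → ℝ) : Prop :=
  ∀ ⦃i j : Fin n⦄, i < j → p i * q j ≤ q i * p j

/-- Predicted belief `P′π`. -/
def predict {n : ℕ} (P : Matrix (Fin n) (Fin n) ℝ) (π : Fin n → ℝ) : Fin n → ℝ :=
  fun j => ∑ i, P i j * π i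

/-- `g′ B_y P′ π` where `B_y = diag(B_{1y},…,B_{Xy})`. -/
def scoreG {X Y : ℕ} (B : Matrix (Fin X) (Fin Y) ℝ) (P : Matrix (Fin X) (Fin X) ℝ)
    (g π : Fin X → ℝ) (y : Fin Y) : ℝ :=
  ∑ i, g i * B i y * predict P π i

/-- Myopic local decision: `(0 : Fin 2)` codes decision `a = 1` (taken when
`g′B_yP′π ≤ 0`), `(1 : Fin 2)` codes decision `a = 2`. -/
noncomputable def astar {X Y : ℕ} (B : Matrix (Fin X) (Fin Y) ℝ)
    (P : Matrix (Fin X) (Fin X) ℝ) (g π : Fin X → ℝ) (y : Fin Y) : Fin 2 :=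
  if scoreG B P g π y ≤ 0 then 0 else 1

/-- The `Y × 2` local decision matrix `M^π`, with a single `1` per row in column `a*(π,y)`. -/
noncomputable def Mdec {X Y : ℕ} (B : Matrix (Fin X) (Fin Y) ℝ)
    (P : Matrix (Fin X) (Fin X) ℝ) (g π : Fin X → ℝ) :
    Matrix (Fin Y) (Fin 2) ℝ :=
  fun y a => if a = astar B P g π y then 1 else 0

/-- The decision likelihood matrix `R^π = B M^π`. -/
noncomputable def Rdec {X Y : ℕ} (B : Matrix (Fin X) (Fin Y) ℝ)
    (P : Matrix (Fin X) (Fin X) ℝ) (g π : Fin X → ℝ) :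
    Matrix (Fin X) (Fin 2) ℝ :=
  fun i a => ∑ y, B i y * Mdec B P g π y a

/-- `σ(π,a) = 1′ R^π_a P′ π`. -/
noncomputable def sigmaSL {X Y : ℕ} (B : Matrix (Fin X) (Fin Y) ℝ)
    (P : Matrix (Fin X) (Fin X) ℝ) (g π : Fin X → ℝ) (a : Fin 2) : ℝ :=
  ∑ i, Rdec B P g π i a * predict P π i

/-- The social learning Bayesian filter `T^π(π,a) = R^π_a P′π / σ(π,a)`. -/
noncomputable def Tsl {X Y : ℕ} (B : Matrix (Fin X) (Fin Y) ℝ)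
    (P : Matrix (Fin X) (Fin X) ℝ) (g π : Fin X → ℝ) (a : Fin 2) : Fin X → ℝ :=
  fun i => Rdec B P g π i a * predict P π i / sigmaSL B P g π a

/-- `σ(π,y) = 1′ B_y P′ π`. -/
noncomputable def sigmaObs {X Y : ℕ} (B : Matrix (Fin X) (Fin Y) ℝ)
    (P : Matrix (Fin X) (Fin X) ℝ) (π : Fin X → ℝ) (y : Fin Y) : ℝ :=
  ∑ i, B i y * predict P π i

/-- The HMM (classical) filter `T(π,y) = B_y P′π / σ(π,y)`. -/
noncomputable def Thmm {X Y : ℕ} (B : Matrix (Fin X) (Fin Y) ℝ)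
    (P : Matrix (Fin X) (Fin X) ℝ) (π : Fin X → ℝ) (y : Fin Y) : Fin X → ℝ :=
  fun i => B i y * predict P π i / sigmaObs B P π y


/-- If the score is positive at `y`, it stays positive at any larger index. -/
lemma scoreG_pos_of_lt {X Y : ℕ}
    (P : Matrix (Fin X) (Fin X) ℝ) (B : Matrix (Fin X) (Fin Y) ℝ) (g π : Fin X → ℝ)
    (hq : ∀ i, 0 ≤ predict P π i) (hBtp2 : isTP2 B) (hBpos : ∀ i y, 0 < B i y)
    (hg : Monotone g) {y z : Fin Y} (hyz : y < z) (h : 0 < scoreG B P g π y) :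
    0 < scoreG B P g π z := by
  have hne : (Finset.univ.filter (fun i => 0 < g i)).Nonempty := by
    by_contra hcon
    rw [Finset.not_nonempty_iff_eq_empty, Finset.filter_eq_empty_iff] at hcon
    have : scoreG B P g π y ≤ 0 := by
      apply Finset.sum_nonpos
      intro i _
      have h1 : g i ≤ 0 := not_lt.mp (hcon (Finset.mem_univ i))
      exact mul_nonpos_of_nonpos_of_nonneg
        (mul_nonpos_of_nonpos_of_nonneg h1 (hBpos i y).le) (hq i)
    linarith
  obtain ⟨k, hk, hmin⟩ := Finset.exists_min_image _ id hne
  simp only [Finset.mem_filter, Finset.mem_univ, true_and, id] at hk hmin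
  have key : B k z * scoreG B P g π y ≤ B k y * scoreG B P g π z := by
    unfold scoreG
    rw [Finset.mul_sum, Finset.mul_sum]
    apply Finset.sum_le_sum
    intro i _
    have h2 : g i * (B k z * B i y) ≤ g i * (B k y * B i z) := by
      rcases lt_trichotomy i k with hik | hik | hik
      · have hgi : g i ≤ 0 := by
          by_contra hc
          exact absurd (hmin i (not_le.mp hc)) (not_le.mpr hik)
        have := hBtp2 hik hyz
        apply mul_le_mul_of_nonpos_left _ hgi
        linarith
      · subst hik
        exact le_of_eq (by ring)
      · exact mul_le_mul_of_nonneg_left (hBtp2 hik hyz) (hk.le.trans (hg hik.le))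
    have := mul_le_mul_of_nonneg_right h2 (hq i)
    linarith
  have h3 : 0 < B k y * scoreG B P g π z := lt_of_lt_of_le (mul_pos (hBpos k z) h) key
  exact pos_of_mul_pos_right h3 (hBpos k y).le

/-- under (A1), (A2) and `g = c₁ − c₂` nondecreasing, the `Y × 2`
local-decision matrix `M^π` is TP2 for every belief `π` in the simplex. -/
theorem Mdec_isTP2 {X Y : ℕ}
    (P : Matrix (Fin X) (Fin X) ℝ) (B : Matrix (Fin X) (Fin Y) ℝ) (g : Fin X → ℝ)
    (hP : rowStochastic P) (hPtp2 : isTP2 P)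
    (hB : rowStochastic B) (hBtp2 : isTP2 B) (hBpos : ∀ i y, 0 < B i y)
    (hg : Monotone g) :
    ∀ π : Fin X → ℝ, isProbVec π → isTP2 (Mdec B P g π) := by
  intro π hπ y z a b hyz hab
  have hq : ∀ i, 0 ≤ predict P π i := fun i =>
    Finset.sum_nonneg fun j _ => mul_nonneg (hP.1 j i) (hπ.1 j)
  have hmono := scoreG_pos_of_lt P B g π hq hBtp2 hBpos hg hyz
  obtain ⟨rfl, rfl⟩ : a = 0 ∧ b = 1 := by omega
  unfold Mdec astar
  by_cases h1 : scoreG B P g π y ≤ 0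
  · by_cases h2 : scoreG B P g π z ≤ 0 <;> simp [h1, h2]
  · have h2 : ¬ scoreG B P g π z ≤ 0 := not_le.mpr (hmono (not_le.mp h1))
    simp [h1, h2]

end QDSL3
end

section
/- Let P be an X×X row-stochastic TP2 matrix, B an X×Y row-stochastic TP2 matrix, and c₁, c₂ local cost vectors. Let π₁, π₂ ∈ Π(X) satisfy π₁ ≥_r π₂ and M^{π₁} = M^{π₂} (i.e., π₁ and π₂ lie in the same polytope, so R^{π₁} = R^{π₂}). Then for each a ∈ {1,2} with σ(π₁,a) > 0 and σ(π₂,a) > 0, the social learning filter is MLR-monotone: T^{π₁}(π₁,a) ≥_r T^{π₂}(π₂,a). -/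
namespace QDSL4

/-- A probability vector on `Fin n` (element of the belief simplex Π(n)). -/
def isProbVec {n : ℕ} (π : Fin n → ℝ) : Prop :=
  (∀ i, 0 ≤ π i) ∧ ∑ i, π i = 1

/-- Row-stochastic matrix: nonnegative entries, each row sums to one. -/
def rowStochastic {m n : ℕ} (A : Matrix (Fin m) (Fin n) ℝ) : Prop :=
  (∀ i j, 0 ≤ A i j) ∧ ∀ i, ∑ j, A i j = 1

/-- Totally positive of order 2: all second-order minors are nonnegative. -/
def isTP2 {m n : ℕ} (A : Matrix (Fin m) (Fin n) ℝ) : Prop :=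
  ∀ ⦃i i' : Fin m⦄ ⦃j j' : Fin n⦄, i < i' → j < j' → A i j' * A i' j ≤ A i j * A i' j'

/-- `mlrLE q p` means `p ≥_r q` in the monotone likelihood ratio order:
`p i * q j ≤ q i * p j` for all `i < j`. -/
def mlrLE {n : ℕ} (q p : Fin n → ℝ) : Prop :=
  ∀ ⦃i j : Fin n⦄, i < j → p i * q j ≤ q i * p j

/-- Predicted belief `P′π`. -/
def predict {n : ℕ} (P : Matrix (Fin n) (Fin n) ℝ) (π : Fin n → ℝ) : Fin n → ℝ :=
  fun j => ∑ i, P i j * π i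

/-- `g′ B_y P′ π` where `B_y = diag(B_{1y},…,B_{Xy})`. -/
def scoreG {X Y : ℕ} (B : Matrix (Fin X) (Fin Y) ℝ) (P : Matrix (Fin X) (Fin X) ℝ)
    (g π : Fin X → ℝ) (y : Fin Y) : ℝ :=
  ∑ i, g i * B i y * predict P π i

/-- Myopic local decision: `(0 : Fin 2)` codes decision `a = 1` (taken when
`g′B_yP′π ≤ 0`), `(1 : Fin 2)` codes decision `a = 2`. -/
noncomputable def astar {X Y : ℕ} (B : Matrix (Fin X) (Fin Y) ℝ)
    (P : Matrix (Fin X) (Fin X) ℝ) (g π : Fin X → ℝ) (y : Fin Y) : Fin 2 :=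
  if scoreG B P g π y ≤ 0 then 0 else 1

/-- The `Y × 2` local decision matrix `M^π`, with a single `1` per row in column `a*(π,y)`. -/
noncomputable def Mdec {X Y : ℕ} (B : Matrix (Fin X) (Fin Y) ℝ)
    (P : Matrix (Fin X) (Fin X) ℝ) (g π : Fin X → ℝ) :
    Matrix (Fin Y) (Fin 2) ℝ :=
  fun y a => if a = astar B P g π y then 1 else 0

/-- The decision likelihood matrix `R^π = B M^π`. -/
noncomputable def Rdec {X Y : ℕ} (B : Matrix (Fin X) (Fin Y) ℝ)
    (P : Matrix (Fin X) (Fin X) ℝ) (g π : Fin X → ℝ) :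
    Matrix (Fin X) (Fin 2) ℝ :=
  fun i a => ∑ y, B i y * Mdec B P g π y a

/-- `σ(π,a) = 1′ R^π_a P′ π`. -/
noncomputable def sigmaSL {X Y : ℕ} (B : Matrix (Fin X) (Fin Y) ℝ)
    (P : Matrix (Fin X) (Fin X) ℝ) (g π : Fin X → ℝ) (a : Fin 2) : ℝ :=
  ∑ i, Rdec B P g π i a * predict P π i

/-- The social learning Bayesian filter `T^π(π,a) = R^π_a P′π / σ(π,a)`. -/
noncomputable def Tsl {X Y : ℕ} (B : Matrix (Fin X) (Fin Y) ℝ)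
    (P : Matrix (Fin X) (Fin X) ℝ) (g π : Fin X → ℝ) (a : Fin 2) : Fin X → ℝ :=
  fun i => Rdec B P g π i a * predict P π i / sigmaSL B P g π a

/-- `σ(π,y) = 1′ B_y P′ π`. -/
noncomputable def sigmaObs {X Y : ℕ} (B : Matrix (Fin X) (Fin Y) ℝ)
    (P : Matrix (Fin X) (Fin X) ℝ) (π : Fin X → ℝ) (y : Fin Y) : ℝ :=
  ∑ i, B i y * predict P π i

/-- The HMM (classical) filter `T(π,y) = B_y P′π / σ(π,y)`. -/
noncomputable def Thmm {X Y : ℕ} (B : Matrix (Fin X) (Fin Y) ℝ)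
    (P : Matrix (Fin X) (Fin X) ℝ) (π : Fin X → ℝ) (y : Fin Y) : Fin X → ℝ :=
  fun i => B i y * predict P π i / sigmaObs B P π y


/-- Prediction with a TP2 kernel preserves the MLR order. -/
lemma predict_mlr {n : ℕ} (P : Matrix (Fin n) (Fin n) ℝ) (hPtp2 : isTP2 P)
    (p q : Fin n → ℝ) (h : mlrLE q p) : mlrLE (predict P q) (predict P p) := by
  intro i j hij
  have e1 : predict P q i * predict P p j - predict P p i * predict P q j
      = ∑ k, ∑ l, P k i * P l j * (q k * p l - p k * q l) := by
    simp only [predict, Finset.sum_mul_sum, ← Finset.sum_sub_distrib]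
    refine Finset.sum_congr rfl fun k _ => Finset.sum_congr rfl fun l _ => ?_
    ring
  have e2 : ∑ k, ∑ l, P k i * P l j * (q k * p l - p k * q l)
      = ∑ k, ∑ l, P l i * P k j * (q l * p k - p l * q k) := Finset.sum_comm
  have e3 : 0 ≤ ∑ k, ∑ l, (P k i * P l j * (q k * p l - p k * q l)
      + P l i * P k j * (q l * p k - p l * q k)) := by
    refine Finset.sum_nonneg fun k _ => Finset.sum_nonneg fun l _ => ?_
    rcases lt_trichotomy k l with hkl | hkl | hkl
    · nlinarith [mul_nonneg (sub_nonneg.2 (hPtp2 hkl hij)) (sub_nonneg.2 (h hkl))]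
    · subst hkl
      apply le_of_eq
      ring
    · nlinarith [mul_nonneg (sub_nonneg.2 (hPtp2 hkl hij)) (sub_nonneg.2 (h hkl))]
  simp only [Finset.sum_add_distrib] at e3
  linarith

/-- if `π₁ ≥_r π₂` lie in the same polytope (`M^{π₁} = M^{π₂}`, so
`R^{π₁} = R^{π₂}`), then the social learning filter is MLR-monotone:
`T^{π₁}(π₁,a) ≥_r T^{π₂}(π₂,a)` for each decision `a` with positive normalization. -/
theorem filter_MLR_monotone_in_pi {X Y : ℕ}
    (P : Matrix (Fin X) (Fin X) ℝ) (B : Matrix (Fin X) (Fin Y) ℝ)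
    (c₁ c₂ : Fin X → ℝ)
    (hP : rowStochastic P) (hPtp2 : isTP2 P)
    (hB : rowStochastic B) (hBtp2 : isTP2 B)
    (π₁ π₂ : Fin X → ℝ) (hπ₁ : isProbVec π₁) (hπ₂ : isProbVec π₂)
    (hmlr : mlrLE π₂ π₁)   -- π₁ ≥_r π₂
    (hpoly : Mdec B P (fun i => c₁ i - c₂ i) π₁ = Mdec B P (fun i => c₁ i - c₂ i) π₂) :
    ∀ a : Fin 2,
      0 < sigmaSL B P (fun i => c₁ i - c₂ i) π₁ a →
      0 < sigmaSL B P (fun i => c₁ i - c₂ i) π₂ a →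
      mlrLE (Tsl B P (fun i => c₁ i - c₂ i) π₂ a)
            (Tsl B P (fun i => c₁ i - c₂ i) π₁ a) := by
  intro a h1 h2 i j hij
  have hR : Rdec B P (fun i => c₁ i - c₂ i) π₁ = Rdec B P (fun i => c₁ i - c₂ i) π₂ := by
    unfold Rdec
    rw [hpoly]
  have hR0 : ∀ k, 0 ≤ Rdec B P (fun i => c₁ i - c₂ i) π₂ k a := by
    intro k
    refine Finset.sum_nonneg fun y _ => mul_nonneg (hB.1 k y) ?_
    unfold Mdec
    split_ifs <;> norm_num
  have hp := predict_mlr P hPtp2 π₁ π₂ hmlr hij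
  have hm := mul_le_mul_of_nonneg_left hp (mul_nonneg (hR0 i) (hR0 j))
  unfold Tsl
  rw [hR, div_mul_div_comm, div_mul_div_comm,
    mul_comm (sigmaSL B P (fun i => c₁ i - c₂ i) π₂ a)]
  refine div_le_div_of_nonneg_right ?_ (mul_pos h1 h2).le
  linarith

end QDSL4
end

section
/- Let P be an X×X row-stochastic TP2 matrix, B an X×Y row-stochastic TP2 matrix with all entries positive, and suppose g = c₁ − c₂ has nondecreasing entries. Then the distribution of the local decision is monotone in the public belief: for π₁, π₂ ∈ Π(X) with π₁ ≥_r π₂, one has σ(π₁,2) ≥ σ(π₂,2), i.e., the probability distribution a ↦ σ(π₁,a) on {1,2} first-order stochastically dominates a ↦ σ(π₂,a). -/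
namespace QDSL5

/-- A probability vector on `Fin n` (element of the belief simplex Π(n)). -/
def isProbVec {n : ℕ} (π : Fin n → ℝ) : Prop :=
  (∀ i, 0 ≤ π i) ∧ ∑ i, π i = 1

/-- Row-stochastic matrix: nonnegative entries, each row sums to one. -/
def rowStochastic {m n : ℕ} (A : Matrix (Fin m) (Fin n) ℝ) : Prop :=
  (∀ i j, 0 ≤ A i j) ∧ ∀ i, ∑ j, A i j = 1

/-- Totally positive of order 2: all second-order minors are nonnegative. -/
def isTP2 {m n : ℕ} (A : Matrix (Fin m) (Fin n) ℝ) : Prop :=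
  ∀ ⦃i i' : Fin m⦄ ⦃j j' : Fin n⦄, i < i' → j < j' → A i j' * A i' j ≤ A i j * A i' j'

/-- `mlrLE q p` means `p ≥_r q` in the monotone likelihood ratio order:
`p i * q j ≤ q i * p j` for all `i < j`. -/
def mlrLE {n : ℕ} (q p : Fin n → ℝ) : Prop :=
  ∀ ⦃i j : Fin n⦄, i < j → p i * q j ≤ q i * p j

/-- Predicted belief `P′π`. -/
def predict {n : ℕ} (P : Matrix (Fin n) (Fin n) ℝ) (π : Fin n → ℝ) : Fin n → ℝ :=
  fun j => ∑ i, P i j * π i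

/-- `g′ B_y P′ π` where `B_y = diag(B_{1y},…,B_{Xy})`. -/
def scoreG {X Y : ℕ} (B : Matrix (Fin X) (Fin Y) ℝ) (P : Matrix (Fin X) (Fin X) ℝ)
    (g π : Fin X → ℝ) (y : Fin Y) : ℝ :=
  ∑ i, g i * B i y * predict P π i

/-- Myopic local decision: `(0 : Fin 2)` codes decision `a = 1` (taken when
`g′B_yP′π ≤ 0`), `(1 : Fin 2)` codes decision `a = 2`. -/
noncomputable def astar {X Y : ℕ} (B : Matrix (Fin X) (Fin Y) ℝ)
    (P : Matrix (Fin X) (Fin X) ℝ) (g π : Fin X → ℝ) (y : Fin Y) : Fin 2 :=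
  if scoreG B P g π y ≤ 0 then 0 else 1

/-- The `Y × 2` local decision matrix `M^π`, with a single `1` per row in column `a*(π,y)`. -/
noncomputable def Mdec {X Y : ℕ} (B : Matrix (Fin X) (Fin Y) ℝ)
    (P : Matrix (Fin X) (Fin X) ℝ) (g π : Fin X → ℝ) :
    Matrix (Fin Y) (Fin 2) ℝ :=
  fun y a => if a = astar B P g π y then 1 else 0

/-- The decision likelihood matrix `R^π = B M^π`. -/
noncomputable def Rdec {X Y : ℕ} (B : Matrix (Fin X) (Fin Y) ℝ)
    (P : Matrix (Fin X) (Fin X) ℝ) (g π : Fin X → ℝ) :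
    Matrix (Fin X) (Fin 2) ℝ :=
  fun i a => ∑ y, B i y * Mdec B P g π y a

/-- `σ(π,a) = 1′ R^π_a P′ π`. -/
noncomputable def sigmaSL {X Y : ℕ} (B : Matrix (Fin X) (Fin Y) ℝ)
    (P : Matrix (Fin X) (Fin X) ℝ) (g π : Fin X → ℝ) (a : Fin 2) : ℝ :=
  ∑ i, Rdec B P g π i a * predict P π i

/-- The social learning Bayesian filter `T^π(π,a) = R^π_a P′π / σ(π,a)`. -/
noncomputable def Tsl {X Y : ℕ} (B : Matrix (Fin X) (Fin Y) ℝ)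
    (P : Matrix (Fin X) (Fin X) ℝ) (g π : Fin X → ℝ) (a : Fin 2) : Fin X → ℝ :=
  fun i => Rdec B P g π i a * predict P π i / sigmaSL B P g π a

/-- `σ(π,y) = 1′ B_y P′ π`. -/
noncomputable def sigmaObs {X Y : ℕ} (B : Matrix (Fin X) (Fin Y) ℝ)
    (P : Matrix (Fin X) (Fin X) ℝ) (π : Fin X → ℝ) (y : Fin Y) : ℝ :=
  ∑ i, B i y * predict P π i

/-- The HMM (classical) filter `T(π,y) = B_y P′π / σ(π,y)`. -/
noncomputable def Thmm {X Y : ℕ} (B : Matrix (Fin X) (Fin Y) ℝ)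
    (P : Matrix (Fin X) (Fin X) ℝ) (π : Fin X → ℝ) (y : Fin Y) : Fin X → ℝ :=
  fun i => B i y * predict P π i / sigmaObs B P π y


theorem sym_sum_nonneg {n : ℕ} (F : Fin n → Fin n → ℝ) (h : ∀ i j, i < j → 0 ≤ F i j + F j i)
    (hd : ∀ i, 0 ≤ F i i) : 0 ≤ ∑ i, ∑ j, F i j := by
  have h1 : ∑ i, ∑ j, F i j = ∑ i, ∑ j, F j i := Finset.sum_comm
  have h2 : 0 ≤ ∑ i, ∑ j, (F i j + F j i) := by
    refine Finset.sum_nonneg fun i _ => Finset.sum_nonneg fun j _ => ?_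
    rcases lt_trichotomy i j with hij | hij | hij
    · exact h i j hij
    · subst hij
      exact add_nonneg (hd i) (hd i)
    · rw [add_comm]
      exact h j i hij
  simp only [Finset.sum_add_distrib] at h2
  linarith

theorem mlr_core {n : ℕ} (p q g : Fin n → ℝ) (h : mlrLE q p) (hg : Monotone g) :
    (∑ i, g i * q i) * (∑ i, p i) ≤ (∑ i, g i * p i) * (∑ i, q i) := by
  have := sym_sum_nonneg (fun i j => g i * p i * q j - g i * q i * p j) (fun i j hij => by
    have h1 := h hij
    have h2 := hg hij.le
    nlinarith [mul_nonneg (sub_nonneg.2 h1) (sub_nonneg.2 h2)]) (fun i => le_of_eq (by ring))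
  simp only [Finset.sum_sub_distrib] at this
  rw [Finset.sum_mul_sum, Finset.sum_mul_sum]
  linarith

theorem predict_mlr {n : ℕ} (P : Matrix (Fin n) (Fin n) ℝ) (hP : isTP2 P) (p q : Fin n → ℝ)
    (h : mlrLE q p) : mlrLE (predict P q) (predict P p) := by
  intro k l hkl
  have := sym_sum_nonneg
    (fun i j => P i k * q i * (P j l * p j) - P i k * p i * (P j l * q j)) (fun i j hij => by
    have h1 := h hij
    have h2 := hP hij hkl
    nlinarith [mul_nonneg (sub_nonneg.2 h1) (sub_nonneg.2 h2)]) (fun i => le_of_eq (by ring))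
  simp only [Finset.sum_sub_distrib] at this
  unfold predict
  rw [Finset.sum_mul_sum, Finset.sum_mul_sum]
  linarith

theorem predict_prob {n : ℕ} (P : Matrix (Fin n) (Fin n) ℝ) (hP : rowStochastic P)
    (p : Fin n → ℝ) (h : isProbVec p) : isProbVec (predict P p) := by
  refine ⟨fun j => Finset.sum_nonneg fun i _ => mul_nonneg (hP.1 i j) (h.1 i), ?_⟩
  unfold predict
  rw [Finset.sum_comm]
  simp only [← Finset.sum_mul, hP.2, one_mul, h.2]

theorem wsum_pos {n : ℕ} (b p : Fin n → ℝ) (hb : ∀ i, 0 < b i) (h : isProbVec p) :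
    0 < ∑ i, b i * p i := by
  have h0 : ∀ i ∈ Finset.univ, 0 ≤ b i * p i := fun i _ => mul_nonneg (hb i).le (h.1 i)
  refine lt_of_le_of_ne (Finset.sum_nonneg h0) fun he => ?_
  have h1 := (Finset.sum_eq_zero_iff_of_nonneg h0).1 he.symm
  have h2 : ∑ i, p i = 0 := Finset.sum_eq_zero fun i hi =>
    (mul_eq_zero.1 (h1 i hi)).resolve_left (hb i).ne'
  linarith [h.2]

theorem score_mono {X Y : ℕ}
    (P : Matrix (Fin X) (Fin X) ℝ) (B : Matrix (Fin X) (Fin Y) ℝ) (g : Fin X → ℝ)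
    (hP : rowStochastic P) (hPtp2 : isTP2 P)
    (hBtp2 : isTP2 B) (hBpos : ∀ i y, 0 < B i y)
    (hg : Monotone g) (p q : Fin X → ℝ) (hp : isProbVec p) (hq : isProbVec q)
    (h : mlrLE q p) (y y' : Fin Y) (hy : y ≤ y') (hs : 0 < scoreG B P g q y) :
    0 < scoreG B P g p y' := by
  have hp' := predict_prob P hP p hp
  have hq' := predict_prob P hP q hq
  have hm := predict_mlr P hPtp2 p q h
  have key := mlr_core (fun i => B i y' * predict P p i) (fun i => B i y * predict P q i) g
    (fun i j hij => by
      have h1 := hm hij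
      have h2 : B i y' * B j y ≤ B i y * B j y' := by
        rcases hy.lt_or_eq with hlt | rfl
        · exact hBtp2 hij hlt
        · exact le_rfl
      have := mul_le_mul h2 h1 (mul_nonneg (hp'.1 i) (hq'.1 j))
        (mul_pos (hBpos i y) (hBpos j y')).le
      dsimp only
      linarith) hg
  have a1 := wsum_pos (fun i => B i y') _ (fun i => hBpos i y') hp'
  have a2 := wsum_pos (fun i => B i y) _ (fun i => hBpos i y) hq'
  simp only [← mul_assoc] at key
  unfold scoreG at hs ⊢
  exact pos_of_mul_pos_left (lt_of_lt_of_le (mul_pos hs a1) key) a2.le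

theorem Mdec_one {X Y : ℕ} (B : Matrix (Fin X) (Fin Y) ℝ)
    (P : Matrix (Fin X) (Fin X) ℝ) (g π : Fin X → ℝ) (y : Fin Y) :
    Mdec B P g π y 1 = if 0 < scoreG B P g π y then 1 else 0 := by
  unfold Mdec astar
  by_cases h : scoreG B P g π y ≤ 0
  · simp [h, not_lt.2 h]
  · simp [h, not_le.1 h]

theorem mlrLE_refl {n : ℕ} (p : Fin n → ℝ) : mlrLE p p := fun _ _ _ => le_rfl

/-- under (A1), (A2) and `g = c₁ − c₂` nondecreasing, the distribution
of the local decision is monotone in the public belief: `π₁ ≥_r π₂` implies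
`σ(π₁,2) ≥ σ(π₂,2)` (decision `a = 2` is coded `(1 : Fin 2)`), i.e. the decision
distribution under `π₁` first-order stochastically dominates that under `π₂`. -/
theorem sigma_stochastically_monotone {X Y : ℕ}
    (P : Matrix (Fin X) (Fin X) ℝ) (B : Matrix (Fin X) (Fin Y) ℝ) (g : Fin X → ℝ)
    (hP : rowStochastic P) (hPtp2 : isTP2 P)
    (hB : rowStochastic B) (hBtp2 : isTP2 B) (hBpos : ∀ i y, 0 < B i y)
    (hg : Monotone g) :
    ∀ π₁ π₂ : Fin X → ℝ, isProbVec π₁ → isProbVec π₂ →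
      mlrLE π₂ π₁ →   -- π₁ ≥_r π₂
      sigmaSL B P g π₂ 1 ≤ sigmaSL B P g π₁ 1 := by
  intro p q hp hq h
  have hM : ∀ (u v : Fin X → ℝ), isProbVec u → isProbVec v → mlrLE v u →
      ∀ y y', y ≤ y' → Mdec B P g v y 1 ≤ Mdec B P g u y' 1 := by
    intro u v hu hv huv y y' hy
    rw [Mdec_one, Mdec_one]
    by_cases hs : 0 < scoreG B P g v y
    · rw [if_pos hs, if_pos (score_mono P B g hP hPtp2 hBtp2 hBpos hg u v hu hv huv y y' hy hs)]
    · rw [if_neg hs]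
      split_ifs <;> norm_num
  have hp' := predict_prob P hP p hp
  have hq' := predict_prob P hP q hq
  have hR : Monotone fun i => Rdec B P g p i 1 := by
    intro i i' hi
    rcases hi.lt_or_eq with hlt | rfl
    · have := mlr_core (B i') (B i) (fun y => Mdec B P g p y 1)
        (fun y y' hy => by
          have := hBtp2 hlt hy
          linarith) (fun y y' hy => hM p p hp hp (mlrLE_refl p) y y' hy)
      rw [hB.2, hB.2, mul_one, mul_one] at this
      unfold Rdec
      simpa only [mul_comm] using this
    · exact le_rfl
  have key := mlr_core _ _ _ (predict_mlr P hPtp2 p q h) hR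
  rw [hp'.2, hq'.2, mul_one, mul_one] at key
  refine le_trans ?_ key
  refine Finset.sum_le_sum fun i _ => mul_le_mul_of_nonneg_right ?_ (hq'.1 i)
  exact Finset.sum_le_sum fun y _ =>
    mul_le_mul_of_nonneg_left (hM p q hp hq h y y le_rfl) (hBpos i y).le

end QDSL5
end

section
/- Let P be an X×X row-stochastic TP2 matrix, B an X×Y row-stochastic TP2 matrix with all entries positive, and suppose g = c₁ − c₂ has nondecreasing entries (so that R^π = B M^π is TP2). Then for every π ∈ Π(X) with σ(π,1) > 0 and σ(π,2) > 0, the social learning filter output is MLR-increasing in the observed decision: T^π(π,2) ≥_r T^π(π,1). -/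
namespace QDSL6

/-- A probability vector on `Fin n` (element of the belief simplex Π(n)). -/
def isProbVec {n : ℕ} (π : Fin n → ℝ) : Prop :=
  (∀ i, 0 ≤ π i) ∧ ∑ i, π i = 1

/-- Row-stochastic matrix: nonnegative entries, each row sums to one. -/
def rowStochastic {m n : ℕ} (A : Matrix (Fin m) (Fin n) ℝ) : Prop :=
  (∀ i j, 0 ≤ A i j) ∧ ∀ i, ∑ j, A i j = 1

/-- Totally positive of order 2: all second-order minors are nonnegative. -/
def isTP2 {m n : ℕ} (A : Matrix (Fin m) (Fin n) ℝ) : Prop :=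
  ∀ ⦃i i' : Fin m⦄ ⦃j j' : Fin n⦄, i < i' → j < j' → A i j' * A i' j ≤ A i j * A i' j'

/-- `mlrLE q p` means `p ≥_r q` in the monotone likelihood ratio order:
`p i * q j ≤ q i * p j` for all `i < j`. -/
def mlrLE {n : ℕ} (q p : Fin n → ℝ) : Prop :=
  ∀ ⦃i j : Fin n⦄, i < j → p i * q j ≤ q i * p j

/-- Predicted belief `P′π`. -/
def predict {n : ℕ} (P : Matrix (Fin n) (Fin n) ℝ) (π : Fin n → ℝ) : Fin n → ℝ :=
  fun j => ∑ i, P i j * π i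

/-- `g′ B_y P′ π` where `B_y = diag(B_{1y},…,B_{Xy})`. -/
def scoreG {X Y : ℕ} (B : Matrix (Fin X) (Fin Y) ℝ) (P : Matrix (Fin X) (Fin X) ℝ)
    (g π : Fin X → ℝ) (y : Fin Y) : ℝ :=
  ∑ i, g i * B i y * predict P π i

/-- Myopic local decision: `(0 : Fin 2)` codes decision `a = 1` (taken when
`g′B_yP′π ≤ 0`), `(1 : Fin 2)` codes decision `a = 2`. -/
noncomputable def astar {X Y : ℕ} (B : Matrix (Fin X) (Fin Y) ℝ)
    (P : Matrix (Fin X) (Fin X) ℝ) (g π : Fin X → ℝ) (y : Fin Y) : Fin 2 :=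
  if scoreG B P g π y ≤ 0 then 0 else 1

/-- The `Y × 2` local decision matrix `M^π`, with a single `1` per row in column `a*(π,y)`. -/
noncomputable def Mdec {X Y : ℕ} (B : Matrix (Fin X) (Fin Y) ℝ)
    (P : Matrix (Fin X) (Fin X) ℝ) (g π : Fin X → ℝ) :
    Matrix (Fin Y) (Fin 2) ℝ :=
  fun y a => if a = astar B P g π y then 1 else 0

/-- The decision likelihood matrix `R^π = B M^π`. -/
noncomputable def Rdec {X Y : ℕ} (B : Matrix (Fin X) (Fin Y) ℝ)
    (P : Matrix (Fin X) (Fin X) ℝ) (g π : Fin X → ℝ) :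
    Matrix (Fin X) (Fin 2) ℝ :=
  fun i a => ∑ y, B i y * Mdec B P g π y a

/-- `σ(π,a) = 1′ R^π_a P′ π`. -/
noncomputable def sigmaSL {X Y : ℕ} (B : Matrix (Fin X) (Fin Y) ℝ)
    (P : Matrix (Fin X) (Fin X) ℝ) (g π : Fin X → ℝ) (a : Fin 2) : ℝ :=
  ∑ i, Rdec B P g π i a * predict P π i

/-- The social learning Bayesian filter `T^π(π,a) = R^π_a P′π / σ(π,a)`. -/
noncomputable def Tsl {X Y : ℕ} (B : Matrix (Fin X) (Fin Y) ℝ)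
    (P : Matrix (Fin X) (Fin X) ℝ) (g π : Fin X → ℝ) (a : Fin 2) : Fin X → ℝ :=
  fun i => Rdec B P g π i a * predict P π i / sigmaSL B P g π a

/-- `σ(π,y) = 1′ B_y P′ π`. -/
noncomputable def sigmaObs {X Y : ℕ} (B : Matrix (Fin X) (Fin Y) ℝ)
    (P : Matrix (Fin X) (Fin X) ℝ) (π : Fin X → ℝ) (y : Fin Y) : ℝ :=
  ∑ i, B i y * predict P π i

/-- The HMM (classical) filter `T(π,y) = B_y P′π / σ(π,y)`. -/
noncomputable def Thmm {X Y : ℕ} (B : Matrix (Fin X) (Fin Y) ℝ)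
    (P : Matrix (Fin X) (Fin X) ℝ) (π : Fin X → ℝ) (y : Fin Y) : Fin X → ℝ :=
  fun i => B i y * predict P π i / sigmaObs B P π y


theorem score_pos_mono {X Y : ℕ}
    (P : Matrix (Fin X) (Fin X) ℝ) (B : Matrix (Fin X) (Fin Y) ℝ) (g π : Fin X → ℝ)
    (hBtp2 : isTP2 B) (hBpos : ∀ i y, 0 < B i y)
    (hg : Monotone g) (hq : ∀ i, 0 ≤ predict P π i) {y z : Fin Y} (hyz : y < z)
    (hs : 0 < scoreG B P g π y) : 0 < scoreG B P g π z := by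
  have hne : ∃ i, 0 < g i := by
    by_contra! h
    refine absurd hs (not_lt.mpr ?_)
    unfold scoreG
    refine Finset.sum_nonpos fun i _ => ?_
    exact mul_nonpos_of_nonpos_of_nonneg
      (mul_nonpos_of_nonpos_of_nonneg (h i) (hBpos i y).le) (hq i)
  obtain ⟨k, hk, hmin⟩ := WellFounded.has_min (wellFounded_lt (α := Fin X)) {i | 0 < g i} hne
  have hk' : 0 < g k := hk
  have key : B k z * scoreG B P g π y ≤ B k y * scoreG B P g π z := by
    unfold scoreG
    rw [Finset.mul_sum, Finset.mul_sum]
    refine Finset.sum_le_sum fun i _ => ?_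
    have h : g i * (B k z * B i y) ≤ g i * (B k y * B i z) := by
      rcases lt_trichotomy i k with h | h | h
      · have h1 : g i ≤ 0 := not_lt.mp fun h' => hmin i h' h
        have := hBtp2 h hyz
        exact mul_le_mul_of_nonpos_left (by linarith) h1
      · subst h
        exact le_of_eq (by ring)
      · have h1 : 0 ≤ g i := hk'.le.trans (hg h.le)
        exact mul_le_mul_of_nonneg_left (hBtp2 h hyz) h1
    have := mul_le_mul_of_nonneg_right h (hq i)
    linarith
  have h1 : 0 < B k y * scoreG B P g π z := lt_of_lt_of_le (mul_pos (hBpos k z) hs) key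
  exact (mul_pos_iff_of_pos_left (hBpos k y)).mp h1

theorem Rdec_tp2 {X Y : ℕ}
    (P : Matrix (Fin X) (Fin X) ℝ) (B : Matrix (Fin X) (Fin Y) ℝ) (g π : Fin X → ℝ)
    (hBtp2 : isTP2 B) (hBpos : ∀ i y, 0 < B i y)
    (hg : Monotone g) (hq : ∀ i, 0 ≤ predict P π i) {i j : Fin X} (hij : i < j) :
    Rdec B P g π i 1 * Rdec B P g π j 0 ≤ Rdec B P g π i 0 * Rdec B P g π j 1 := by
  rw [mul_comm (Rdec B P g π i 0)]
  unfold Rdec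
  rw [Finset.sum_mul_sum, Finset.sum_mul_sum]
  refine Finset.sum_le_sum fun y _ => Finset.sum_le_sum fun z _ => ?_
  unfold Mdec astar
  by_cases hy : scoreG B P g π y ≤ 0
  · simp [hy]
  by_cases hz : scoreG B P g π z ≤ 0
  · have hzy : z < y := by
      rcases lt_trichotomy z y with h | h | h
      · exact h
      · exact absurd (h ▸ hz) hy
      · exact absurd hz (not_le.mpr
          (score_pos_mono P B g π hBtp2 hBpos hg hq h (not_le.mp hy)))
    have := hBtp2 hij hzy
    simp only [hy, hz, if_true, if_false, mul_one]
    linarith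
  · simp [hz]

/-- under (A1), (A2) and `g = c₁ − c₂` nondecreasing (so `R^π = B M^π`
is TP2), the social learning filter output is MLR-increasing in the observed local
decision: `T^π(π,2) ≥_r T^π(π,1)` (decisions `1, 2` coded `0, 1 : Fin 2`). -/
theorem filter_MLR_increasing_in_a {X Y : ℕ}
    (P : Matrix (Fin X) (Fin X) ℝ) (B : Matrix (Fin X) (Fin Y) ℝ) (g : Fin X → ℝ)
    (hP : rowStochastic P) (hPtp2 : isTP2 P)
    (hB : rowStochastic B) (hBtp2 : isTP2 B) (hBpos : ∀ i y, 0 < B i y)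
    (hg : Monotone g) :
    ∀ π : Fin X → ℝ, isProbVec π →
      0 < sigmaSL B P g π 0 → 0 < sigmaSL B P g π 1 →
      mlrLE (Tsl B P g π 0) (Tsl B P g π 1) := by
  intro π hπ h0 h1 i j hij
  have hq : ∀ i, 0 ≤ predict P π i := fun k =>
    Finset.sum_nonneg fun l _ => mul_nonneg (hP.1 l k) (hπ.1 l)
  have hR := Rdec_tp2 P B g π hBtp2 hBpos hg hq hij
  unfold Tsl
  rw [div_mul_div_comm, div_mul_div_comm, mul_comm (sigmaSL B P g π 1)]
  refine div_le_div_of_nonneg_right ?_ (mul_pos h0 h1).le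
  have := mul_le_mul_of_nonneg_right hR (mul_nonneg (hq i) (hq j))
  linarith

end QDSL6
end

section
/- Blackwell-dominance/Jensen step: let P be an X×X row-stochastic matrix, B an X×Y row-stochastic matrix, M a Y×A row-stochastic matrix, and R = B M. Fix π ∈ Π(X) and define σ(π,y) = 1′B_yP′π, T(π,y) = B_yP′π/σ(π,y), σ(π,a) = 1′R_aP′π, T_R(π,a) = R_aP′π/σ(π,a), where B_y and R_a are the diagonal matrices formed from column y of B and column a of R respectively (terms with zero denominator are omitted). If W : Π(X) → ℝ is concave, then Σ_{a: σ(π,a)>0} W(T_R(π,a)) σ(π,a) ≥ Σ_{y: σ(π,y)>0} W(T(π,y)) σ(π,y). -/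
namespace QDSL9

/-- A probability vector on `Fin n` (element of the belief simplex Π(n)). -/
def isProbVec {n : ℕ} (π : Fin n → ℝ) : Prop :=
  (∀ i, 0 ≤ π i) ∧ ∑ i, π i = 1

/-- Row-stochastic matrix: nonnegative entries, each row sums to one. -/
def rowStochastic {m n : ℕ} (A : Matrix (Fin m) (Fin n) ℝ) : Prop :=
  (∀ i j, 0 ≤ A i j) ∧ ∀ i, ∑ j, A i j = 1

/-- Totally positive of order 2: all second-order minors are nonnegative. -/
def isTP2 {m n : ℕ} (A : Matrix (Fin m) (Fin n) ℝ) : Prop :=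
  ∀ ⦃i i' : Fin m⦄ ⦃j j' : Fin n⦄, i < i' → j < j' → A i j' * A i' j ≤ A i j * A i' j'

/-- `mlrLE q p` means `p ≥_r q` in the monotone likelihood ratio order:
`p i * q j ≤ q i * p j` for all `i < j`. -/
def mlrLE {n : ℕ} (q p : Fin n → ℝ) : Prop :=
  ∀ ⦃i j : Fin n⦄, i < j → p i * q j ≤ q i * p j

/-- Predicted belief `P′π`. -/
def predict {n : ℕ} (P : Matrix (Fin n) (Fin n) ℝ) (π : Fin n → ℝ) : Fin n → ℝ :=
  fun j => ∑ i, P i j * π i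

/-- `g′ B_y P′ π` where `B_y = diag(B_{1y},…,B_{Xy})`. -/
def scoreG {X Y : ℕ} (B : Matrix (Fin X) (Fin Y) ℝ) (P : Matrix (Fin X) (Fin X) ℝ)
    (g π : Fin X → ℝ) (y : Fin Y) : ℝ :=
  ∑ i, g i * B i y * predict P π i

/-- Myopic local decision: `(0 : Fin 2)` codes decision `a = 1` (taken when
`g′B_yP′π ≤ 0`), `(1 : Fin 2)` codes decision `a = 2`. -/
noncomputable def astar {X Y : ℕ} (B : Matrix (Fin X) (Fin Y) ℝ)
    (P : Matrix (Fin X) (Fin X) ℝ) (g π : Fin X → ℝ) (y : Fin Y) : Fin 2 :=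
  if scoreG B P g π y ≤ 0 then 0 else 1

/-- The `Y × 2` local decision matrix `M^π`, with a single `1` per row in column `a*(π,y)`. -/
noncomputable def Mdec {X Y : ℕ} (B : Matrix (Fin X) (Fin Y) ℝ)
    (P : Matrix (Fin X) (Fin X) ℝ) (g π : Fin X → ℝ) :
    Matrix (Fin Y) (Fin 2) ℝ :=
  fun y a => if a = astar B P g π y then 1 else 0

/-- The decision likelihood matrix `R^π = B M^π`. -/
noncomputable def Rdec {X Y : ℕ} (B : Matrix (Fin X) (Fin Y) ℝ)
    (P : Matrix (Fin X) (Fin X) ℝ) (g π : Fin X → ℝ) :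
    Matrix (Fin X) (Fin 2) ℝ :=
  fun i a => ∑ y, B i y * Mdec B P g π y a

/-- `σ(π,a) = 1′ R^π_a P′ π`. -/
noncomputable def sigmaSL {X Y : ℕ} (B : Matrix (Fin X) (Fin Y) ℝ)
    (P : Matrix (Fin X) (Fin X) ℝ) (g π : Fin X → ℝ) (a : Fin 2) : ℝ :=
  ∑ i, Rdec B P g π i a * predict P π i

/-- The social learning Bayesian filter `T^π(π,a) = R^π_a P′π / σ(π,a)`. -/
noncomputable def Tsl {X Y : ℕ} (B : Matrix (Fin X) (Fin Y) ℝ)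
    (P : Matrix (Fin X) (Fin X) ℝ) (g π : Fin X → ℝ) (a : Fin 2) : Fin X → ℝ :=
  fun i => Rdec B P g π i a * predict P π i / sigmaSL B P g π a

/-- `σ(π,y) = 1′ B_y P′ π`. -/
noncomputable def sigmaObs {X Y : ℕ} (B : Matrix (Fin X) (Fin Y) ℝ)
    (P : Matrix (Fin X) (Fin X) ℝ) (π : Fin X → ℝ) (y : Fin Y) : ℝ :=
  ∑ i, B i y * predict P π i

/-- The HMM (classical) filter `T(π,y) = B_y P′π / σ(π,y)`. -/
noncomputable def Thmm {X Y : ℕ} (B : Matrix (Fin X) (Fin Y) ℝ)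
    (P : Matrix (Fin X) (Fin X) ℝ) (π : Fin X → ℝ) (y : Fin Y) : Fin X → ℝ :=
  fun i => B i y * predict P π i / sigmaObs B P π y


/-- `R = B M` with explicit entries. -/
noncomputable def Rmat {X Y A : ℕ} (B : Matrix (Fin X) (Fin Y) ℝ)
    (M : Matrix (Fin Y) (Fin A) ℝ) : Matrix (Fin X) (Fin A) ℝ :=
  fun i a => ∑ y, B i y * M y a

/-- `σ(π,a) = 1′ R_a P′ π` for the garbled channel `R = B M`. -/
noncomputable def sigmaR {X Y A : ℕ} (B : Matrix (Fin X) (Fin Y) ℝ)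
    (M : Matrix (Fin Y) (Fin A) ℝ) (P : Matrix (Fin X) (Fin X) ℝ)
    (π : Fin X → ℝ) (a : Fin A) : ℝ :=
  ∑ i, Rmat B M i a * predict P π i

/-- `T_R(π,a) = R_a P′ π / σ(π,a)`. -/
noncomputable def TR {X Y A : ℕ} (B : Matrix (Fin X) (Fin Y) ℝ)
    (M : Matrix (Fin Y) (Fin A) ℝ) (P : Matrix (Fin X) (Fin X) ℝ)
    (π : Fin X → ℝ) (a : Fin A) : Fin X → ℝ :=
  fun i => Rmat B M i a * predict P π i / sigmaR B M P π a

/-- Concavity on the simplex. -/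
def concaveOnSimplex {n : ℕ} (W : (Fin n → ℝ) → ℝ) : Prop :=
  ∀ π₁ π₂ : Fin n → ℝ, isProbVec π₁ → isProbVec π₂ → ∀ γ : ℝ, 0 ≤ γ → γ ≤ 1 →
    γ * W π₁ + (1 - γ) * W π₂ ≤ W (fun i => γ * π₁ i + (1 - γ) * π₂ i)

/-- Blackwell-dominance / Jensen step: for `R = B M` with `M` stochastic
and `W` concave, the expected value of `W` after the garbled update dominates the
expected value after the fine update. -/
theorem blackwell_jensen_step {X Y A : ℕ}
    (P : Matrix (Fin X) (Fin X) ℝ) (B : Matrix (Fin X) (Fin Y) ℝ)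
    (M : Matrix (Fin Y) (Fin A) ℝ)
    (hP : rowStochastic P) (hB : rowStochastic B) (hM : rowStochastic M)
    (π : Fin X → ℝ) (hπ : isProbVec π)
    (W : (Fin X → ℝ) → ℝ) (hW : concaveOnSimplex W) :
    ∑ y ∈ Finset.univ.filter (fun y => 0 < sigmaObs B P π y),
        W (Thmm B P π y) * sigmaObs B P π y ≤
      ∑ a ∈ Finset.univ.filter (fun a => 0 < sigmaR B M P π a),
        W (TR B M P π a) * sigmaR B M P π a := by
  have hq : ∀ i, 0 ≤ predict P π i := fun i =>
    Finset.sum_nonneg fun j _ => mul_nonneg (hP.1 j i) (hπ.1 j)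
  have hS : ∀ y, 0 ≤ sigmaObs B P π y := fun y =>
    Finset.sum_nonneg fun i _ => mul_nonneg (hB.1 i y) (hq i)
  have hS0 : ∀ y, ¬ 0 < sigmaObs B P π y → sigmaObs B P π y = 0 := fun y h =>
    le_antisymm (not_lt.mp h) (hS y)
  -- unnormalised posterior
  have hT : ∀ y i, sigmaObs B P π y * Thmm B P π y i = B i y * predict P π i := by
    intro y i
    by_cases h : 0 < sigmaObs B P π y
    · simp only [Thmm]
      field_simp
    · have h0 := hS0 y h
      have h1 := (Finset.sum_eq_zero_iff_of_nonneg
        (fun i _ => mul_nonneg (hB.1 i y) (hq i))).mp h0 i (Finset.mem_univ i)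
      rw [h0, h1, zero_mul]
  have hTp : ∀ y, 0 < sigmaObs B P π y → Thmm B P π y ∈ {p : Fin X → ℝ | isProbVec p} := by
    intro y h
    refine ⟨fun i => div_nonneg (mul_nonneg (hB.1 i y) (hq i)) h.le, ?_⟩
    simp only [Thmm]
    rw [← Finset.sum_div]
    exact div_self h.ne'
  have hR : ∀ a i, Rmat B M i a * predict P π i
      = ∑ y, M y a * sigmaObs B P π y * Thmm B P π y i := by
    intro a i
    simp only [Rmat]
    rw [Finset.sum_mul]
    refine Finset.sum_congr rfl fun y _ => ?_
    rw [mul_assoc (M y a), hT]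
    ring
  have hσ : ∀ a, sigmaR B M P π a = ∑ y, M y a * sigmaObs B P π y := by
    intro a
    simp only [sigmaR, sigmaObs, Rmat]
    simp_rw [Finset.sum_mul, Finset.mul_sum]
    rw [Finset.sum_comm]
    refine Finset.sum_congr rfl fun y _ => Finset.sum_congr rfl fun i _ => by ring
  have hfil : ∀ (a : Fin A) (f : Fin Y → ℝ),
      ∑ y ∈ Finset.univ.filter (fun y => 0 < sigmaObs B P π y), M y a * sigmaObs B P π y * f y
        = ∑ y, M y a * sigmaObs B P π y * f y := by
    intro a f
    refine Finset.sum_filter_of_ne fun y _ hne => ?_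
    by_contra h
    exact hne (by rw [hS0 y h]; ring)
  have hconc : ConcaveOn ℝ {p : Fin X → ℝ | isProbVec p} W := by
    refine ⟨?_, ?_⟩
    · intro p hp q hq' s t hs ht hst
      refine ⟨fun i => ?_, ?_⟩
      · have := mul_nonneg hs (hp.1 i)
        have := mul_nonneg ht (hq'.1 i)
        simp only [Pi.add_apply, Pi.smul_apply, smul_eq_mul]
        linarith
      · simp only [Pi.add_apply, Pi.smul_apply, smul_eq_mul]
        rw [Finset.sum_add_distrib, ← Finset.mul_sum, ← Finset.mul_sum, hp.2, hq'.2]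
        linarith
    · intro p hp q hq' s t hs ht hst
      obtain rfl : t = 1 - s := by linarith
      exact hW p q hp hq' s hs (by linarith)
  have hlhs : ∑ y ∈ Finset.univ.filter (fun y => 0 < sigmaObs B P π y),
        W (Thmm B P π y) * sigmaObs B P π y
      = ∑ a, ∑ y, M y a * sigmaObs B P π y * W (Thmm B P π y) := by
    rw [Finset.sum_comm]
    rw [Finset.sum_filter_of_ne]
    · refine Finset.sum_congr rfl fun y _ => ?_
      rw [← Finset.sum_mul, ← Finset.sum_mul, hM.2 y]
      ring
    · intro y _ hne
      by_contra h
      exact hne (by rw [hS0 y h]; ring)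
  rw [hlhs, Finset.sum_filter]
  refine Finset.sum_le_sum fun a _ => ?_
  split_ifs with ha
  · have hJ := hconc.le_map_sum
      (t := Finset.univ.filter (fun y => 0 < sigmaObs B P π y))
      (w := fun y => M y a * sigmaObs B P π y / sigmaR B M P π a)
      (p := fun y => Thmm B P π y)
      (fun y _ => div_nonneg (mul_nonneg (hM.1 y a) (hS y)) ha.le)
      (by
        have h := hfil a (fun _ => 1)
        simp only [mul_one] at h
        rw [← Finset.sum_div, h, ← hσ]
        exact div_self ha.ne')
      (fun y hy => hTp y (Finset.mem_filter.mp hy).2)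
    have hpt : ∑ y ∈ Finset.univ.filter (fun y => 0 < sigmaObs B P π y),
        (M y a * sigmaObs B P π y / sigmaR B M P π a) • Thmm B P π y = TR B M P π a := by
      funext i
      simp only [Finset.sum_apply, Pi.smul_apply, smul_eq_mul, TR]
      rw [hR, ← hfil a (fun y => Thmm B P π y i), Finset.sum_div]
      exact Finset.sum_congr rfl fun y _ => by ring
    rw [hpt] at hJ
    have hval : ∑ y ∈ Finset.univ.filter (fun y => 0 < sigmaObs B P π y),
        (M y a * sigmaObs B P π y / sigmaR B M P π a) • W (Thmm B P π y)
        = (∑ y, M y a * sigmaObs B P π y * W (Thmm B P π y)) / sigmaR B M P π a := by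
      rw [← hfil a (fun y => W (Thmm B P π y)), Finset.sum_div]
      exact Finset.sum_congr rfl fun y _ => by rw [smul_eq_mul]; ring
    rw [hval] at hJ
    exact (div_le_iff₀ ha).mp hJ
  · have hnn : ∀ y ∈ Finset.univ, 0 ≤ M y a * sigmaObs B P π y :=
      fun y _ => mul_nonneg (hM.1 y a) (hS y)
    have h0 : ∑ y, M y a * sigmaObs B P π y = 0 :=
      le_antisymm (by rw [← hσ]; exact not_lt.mp ha) (Finset.sum_nonneg hnn)
    refine (Finset.sum_eq_zero fun y hy => ?_).le
    rw [(Finset.sum_eq_zero_iff_of_nonneg hnn).mp h0 y hy, zero_mul]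

end QDSL9
end

section
/- Quickest detection with social learning is always at least as expensive as classical quickest detection: let ρ ∈ [0,1), C ∈ ℝ^X, P an X×X row-stochastic matrix, B an X×Y row-stochastic matrix with all entries positive, and c₁, c₂ local cost vectors defining M^π, R^π = B M^π and the social learning filter. Let V̲ be the unique bounded fixed point of the classical Bellman operator (𝒯₀W)(π) = min{0, C′π + ρ Σ_y W(T(π,y)) σ(π,y)} and V the unique bounded fixed point of the social learning Bellman operator (𝒯₁W)(π) = min{0, C′π + ρ Σ_{a∈{1,2}: σ(π,a)>0} W(T^π(π,a)) σ(π,a)}. Then V̲(π) ≤ V(π) for every π ∈ Π(X). -/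
namespace QDSL11

/-- A probability vector on `Fin n` (element of the belief simplex Π(n)). -/
def isProbVec {n : ℕ} (π : Fin n → ℝ) : Prop :=
  (∀ i, 0 ≤ π i) ∧ ∑ i, π i = 1

/-- Row-stochastic matrix: nonnegative entries, each row sums to one. -/
def rowStochastic {m n : ℕ} (A : Matrix (Fin m) (Fin n) ℝ) : Prop :=
  (∀ i j, 0 ≤ A i j) ∧ ∀ i, ∑ j, A i j = 1

/-- Totally positive of order 2: all second-order minors are nonnegative. -/
def isTP2 {m n : ℕ} (A : Matrix (Fin m) (Fin n) ℝ) : Prop :=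
  ∀ ⦃i i' : Fin m⦄ ⦃j j' : Fin n⦄, i < i' → j < j' → A i j' * A i' j ≤ A i j * A i' j'

/-- `mlrLE q p` means `p ≥_r q` in the monotone likelihood ratio order:
`p i * q j ≤ q i * p j` for all `i < j`. -/
def mlrLE {n : ℕ} (q p : Fin n → ℝ) : Prop :=
  ∀ ⦃i j : Fin n⦄, i < j → p i * q j ≤ q i * p j

/-- Predicted belief `P′π`. -/
def predict {n : ℕ} (P : Matrix (Fin n) (Fin n) ℝ) (π : Fin n → ℝ) : Fin n → ℝ :=
  fun j => ∑ i, P i j * π i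

/-- `g′ B_y P′ π` where `B_y = diag(B_{1y},…,B_{Xy})`. -/
def scoreG {X Y : ℕ} (B : Matrix (Fin X) (Fin Y) ℝ) (P : Matrix (Fin X) (Fin X) ℝ)
    (g π : Fin X → ℝ) (y : Fin Y) : ℝ :=
  ∑ i, g i * B i y * predict P π i

/-- Myopic local decision: `(0 : Fin 2)` codes decision `a = 1` (taken when
`g′B_yP′π ≤ 0`), `(1 : Fin 2)` codes decision `a = 2`. -/
noncomputable def astar {X Y : ℕ} (B : Matrix (Fin X) (Fin Y) ℝ)
    (P : Matrix (Fin X) (Fin X) ℝ) (g π : Fin X → ℝ) (y : Fin Y) : Fin 2 :=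
  if scoreG B P g π y ≤ 0 then 0 else 1

/-- The `Y × 2` local decision matrix `M^π`, with a single `1` per row in column `a*(π,y)`. -/
noncomputable def Mdec {X Y : ℕ} (B : Matrix (Fin X) (Fin Y) ℝ)
    (P : Matrix (Fin X) (Fin X) ℝ) (g π : Fin X → ℝ) :
    Matrix (Fin Y) (Fin 2) ℝ :=
  fun y a => if a = astar B P g π y then 1 else 0

/-- The decision likelihood matrix `R^π = B M^π`. -/
noncomputable def Rdec {X Y : ℕ} (B : Matrix (Fin X) (Fin Y) ℝ)
    (P : Matrix (Fin X) (Fin X) ℝ) (g π : Fin X → ℝ) :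
    Matrix (Fin X) (Fin 2) ℝ :=
  fun i a => ∑ y, B i y * Mdec B P g π y a

/-- `σ(π,a) = 1′ R^π_a P′ π`. -/
noncomputable def sigmaSL {X Y : ℕ} (B : Matrix (Fin X) (Fin Y) ℝ)
    (P : Matrix (Fin X) (Fin X) ℝ) (g π : Fin X → ℝ) (a : Fin 2) : ℝ :=
  ∑ i, Rdec B P g π i a * predict P π i

/-- The social learning Bayesian filter `T^π(π,a) = R^π_a P′π / σ(π,a)`. -/
noncomputable def Tsl {X Y : ℕ} (B : Matrix (Fin X) (Fin Y) ℝ)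
    (P : Matrix (Fin X) (Fin X) ℝ) (g π : Fin X → ℝ) (a : Fin 2) : Fin X → ℝ :=
  fun i => Rdec B P g π i a * predict P π i / sigmaSL B P g π a

/-- `σ(π,y) = 1′ B_y P′ π`. -/
noncomputable def sigmaObs {X Y : ℕ} (B : Matrix (Fin X) (Fin Y) ℝ)
    (P : Matrix (Fin X) (Fin X) ℝ) (π : Fin X → ℝ) (y : Fin Y) : ℝ :=
  ∑ i, B i y * predict P π i

/-- The HMM (classical) filter `T(π,y) = B_y P′π / σ(π,y)`. -/
noncomputable def Thmm {X Y : ℕ} (B : Matrix (Fin X) (Fin Y) ℝ)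
    (P : Matrix (Fin X) (Fin X) ℝ) (π : Fin X → ℝ) (y : Fin Y) : Fin X → ℝ :=
  fun i => B i y * predict P π i / sigmaObs B P π y


/-- Bounded on the belief simplex. -/
def boundedOnSimplex {n : ℕ} (W : (Fin n → ℝ) → ℝ) : Prop :=
  ∃ K : ℝ, ∀ π : Fin n → ℝ, isProbVec π → |W π| ≤ K

/-- The classical quickest-detection Bellman operator. -/
noncomputable def bellman0 {X Y : ℕ} (C : Fin X → ℝ) (ρ : ℝ)
    (P : Matrix (Fin X) (Fin X) ℝ) (B : Matrix (Fin X) (Fin Y) ℝ)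
    (W : (Fin X → ℝ) → ℝ) : (Fin X → ℝ) → ℝ :=
  fun π => min 0 ((∑ i, C i * π i) + ρ * ∑ y, W (Thmm B P π y) * sigmaObs B P π y)

/-- The social-learning quickest-detection Bellman operator (terms with
`σ(π,a) = 0` omitted). -/
noncomputable def bellman1 {X Y : ℕ} (C : Fin X → ℝ) (ρ : ℝ)
    (P : Matrix (Fin X) (Fin X) ℝ) (B : Matrix (Fin X) (Fin Y) ℝ)
    (g : Fin X → ℝ) (W : (Fin X → ℝ) → ℝ) : (Fin X → ℝ) → ℝ :=
  fun π => min 0 ((∑ i, C i * π i) +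
    ρ * ∑ a ∈ Finset.univ.filter (fun a => 0 < sigmaSL B P g π a),
      W (Tsl B P g π a) * sigmaSL B P g π a)

/-- Homogeneous (degree one) extension of a function on the simplex. -/
noncomputable def homExt {n : ℕ} (W : (Fin n → ℝ) → ℝ) (u : Fin n → ℝ) : ℝ :=
  W (fun i => u i / ∑ j, u j) * ∑ j, u j

/-- Unnormalised filter update `B_y P′ u`. -/
def updY {X Y : ℕ} (B : Matrix (Fin X) (Fin Y) ℝ) (P : Matrix (Fin X) (Fin X) ℝ)
    (u : Fin X → ℝ) (y : Fin Y) : Fin X → ℝ :=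
  fun i => B i y * predict P u i

lemma probVec_normalize {n : ℕ} (u : Fin n → ℝ) (hu : ∀ i, 0 ≤ u i) (hs : 0 < ∑ j, u j) :
    isProbVec (fun i => u i / ∑ j, u j) := by
  refine ⟨fun i => div_nonneg (hu i) hs.le, ?_⟩
  rw [← Finset.sum_div]
  exact div_self hs.ne'

lemma homExt_zero {n : ℕ} (W : (Fin n → ℝ) → ℝ) (u : Fin n → ℝ) (hs : ∑ j, u j = 0) :
    homExt W u = 0 := by
  simp [homExt, hs]

lemma homExt_prob {n : ℕ} (W : (Fin n → ℝ) → ℝ) (u : Fin n → ℝ) (h : isProbVec u) :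
    homExt W u = W u := by
  simp [homExt, h.2]

lemma homExt_smul {n : ℕ} (W : (Fin n → ℝ) → ℝ) (u : Fin n → ℝ) (s : ℝ) (hs : 0 < s) :
    homExt W (fun i => u i / s) = homExt W u / s := by
  have h1 : ∑ j, u j / s = (∑ j, u j) / s := (Finset.sum_div _ _ _).symm
  have h2 : (fun i => u i / s / ((∑ j, u j) / s)) = fun i => u i / ∑ j, u j := by
    funext i
    exact div_div_div_cancel_right₀ hs.ne' _ _
  unfold homExt
  simp only [h1]
  rw [h2]
  ring

lemma homExt_le {n : ℕ} (W W' : (Fin n → ℝ) → ℝ) (E : ℝ)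
    (h : ∀ π, isProbVec π → W π ≤ W' π + E) (u : Fin n → ℝ) (hu : ∀ i, 0 ≤ u i) :
    homExt W u ≤ homExt W' u + E * ∑ j, u j := by
  rcases (Finset.sum_nonneg fun i _ => hu i : 0 ≤ ∑ j, u j).eq_or_lt with h0 | h0
  · rw [homExt_zero _ _ h0.symm, homExt_zero _ _ h0.symm, ← h0]; simp
  · unfold homExt
    have := mul_le_mul_of_nonneg_right (h _ (probVec_normalize u hu h0)) h0.le
    linarith

lemma predict_nonneg {n : ℕ} (P : Matrix (Fin n) (Fin n) ℝ) (hP : rowStochastic P)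
    (u : Fin n → ℝ) (hu : ∀ i, 0 ≤ u i) (j : Fin n) : 0 ≤ predict P u j :=
  Finset.sum_nonneg fun i _ => mul_nonneg (hP.1 i j) (hu i)

lemma sum_predict {n : ℕ} (P : Matrix (Fin n) (Fin n) ℝ) (hP : rowStochastic P)
    (u : Fin n → ℝ) : ∑ j, predict P u j = ∑ i, u i := by
  unfold predict
  rw [Finset.sum_comm]
  refine Finset.sum_congr rfl fun i _ => ?_
  rw [← Finset.sum_mul, hP.2 i, one_mul]

lemma updY_nonneg {X Y : ℕ} (B : Matrix (Fin X) (Fin Y) ℝ) (P : Matrix (Fin X) (Fin X) ℝ)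
    (hP : rowStochastic P) (hB : rowStochastic B) (u : Fin X → ℝ) (hu : ∀ i, 0 ≤ u i)
    (y : Fin Y) (i : Fin X) : 0 ≤ updY B P u y i :=
  mul_nonneg (hB.1 i y) (predict_nonneg P hP u hu i)

lemma sum_updY {X Y : ℕ} (B : Matrix (Fin X) (Fin Y) ℝ) (P : Matrix (Fin X) (Fin X) ℝ)
    (hP : rowStochastic P) (hB : rowStochastic B) (u : Fin X → ℝ) :
    ∑ y, ∑ i, updY B P u y i = ∑ i, u i := by
  rw [Finset.sum_comm, ← sum_predict P hP u]
  refine Finset.sum_congr rfl fun i _ => ?_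
  unfold updY
  rw [← Finset.sum_mul, hB.2 i, one_mul]

lemma updY_add {X Y : ℕ} (B : Matrix (Fin X) (Fin Y) ℝ) (P : Matrix (Fin X) (Fin X) ℝ)
    (u v : Fin X → ℝ) (y : Fin Y) : updY B P (u + v) y = updY B P u y + updY B P v y := by
  funext i
  simp [updY, predict, mul_add, Finset.sum_add_distrib]

lemma updY_div {X Y : ℕ} (B : Matrix (Fin X) (Fin Y) ℝ) (P : Matrix (Fin X) (Fin X) ℝ)
    (u : Fin X → ℝ) (s : ℝ) (y : Fin Y) :
    updY B P (fun i => u i / s) y = fun i => updY B P u y i / s := by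
  funext i
  simp only [updY, predict, mul_div_assoc, Finset.sum_div]

lemma bellman0_eq {X Y : ℕ} (C : Fin X → ℝ) (ρ : ℝ)
    (P : Matrix (Fin X) (Fin X) ℝ) (B : Matrix (Fin X) (Fin Y) ℝ)
    (W : (Fin X → ℝ) → ℝ) (π : Fin X → ℝ) :
    bellman0 C ρ P B W π
      = min 0 ((∑ i, C i * π i) + ρ * ∑ y, homExt W (updY B P π y)) := rfl

lemma homExt_fix {X Y : ℕ} (C : Fin X → ℝ) (ρ : ℝ)
    (P : Matrix (Fin X) (Fin X) ℝ) (B : Matrix (Fin X) (Fin Y) ℝ)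
    (W : (Fin X → ℝ) → ℝ)
    (hW : ∀ π : Fin X → ℝ, isProbVec π → W π = bellman0 C ρ P B W π)
    (u : Fin X → ℝ) (hu : ∀ i, 0 ≤ u i) :
    homExt W u = min 0 ((∑ i, C i * u i) + ρ * ∑ y, homExt W (updY B P u y)) := by
  rcases (Finset.sum_nonneg fun i _ => hu i : 0 ≤ ∑ j, u j).eq_or_lt with h0 | h0
  · have hz : ∀ i, u i = 0 := fun i =>
      (Finset.sum_eq_zero_iff_of_nonneg fun i _ => hu i).1 h0.symm i (Finset.mem_univ i)
    have hz' : ∀ y, homExt W (updY B P u y) = 0 := fun y =>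
      homExt_zero _ _ (by simp [updY, predict, hz])
    rw [homExt_zero _ _ h0.symm]
    simp [hz, hz']
  · have key := hW _ (probVec_normalize u hu h0)
    rw [bellman0_eq] at key
    simp only [updY_div, homExt_smul W _ _ h0, ← mul_div_assoc, ← Finset.sum_div] at key
    rw [← add_div] at key
    unfold homExt
    rw [key, min_mul_of_nonneg _ _ h0.le, zero_mul, div_mul_cancel₀ _ h0.ne']
    rfl

lemma superadd_approx {X Y : ℕ} (C : Fin X → ℝ) (ρ : ℝ) (hρ0 : 0 ≤ ρ)
    (P : Matrix (Fin X) (Fin X) ℝ) (B : Matrix (Fin X) (Fin Y) ℝ)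
    (hP : rowStochastic P) (hB : rowStochastic B)
    (W : (Fin X → ℝ) → ℝ) (K : ℝ) (hK : ∀ π : Fin X → ℝ, isProbVec π → |W π| ≤ K)
    (hW : ∀ π : Fin X → ℝ, isProbVec π → W π = bellman0 C ρ P B W π) (n : ℕ) :
    ∀ u v : Fin X → ℝ, (∀ i, 0 ≤ u i) → (∀ i, 0 ≤ v i) →
      homExt W u + homExt W v
        ≤ homExt W (u + v) + ρ ^ n * (2 * K * ((∑ i, u i) + ∑ i, v i)) := by
  induction n with
  | zero =>
    intro u v hu hv
    have h1 : ∀ π, isProbVec π → W π ≤ (fun _ => 0) π + K := fun π h => by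
      simpa using (abs_le.1 (hK π h)).2
    have h2 : ∀ π, isProbVec π → (fun _ => (0:ℝ)) π ≤ W π + K := fun π h => by
      have := (abs_le.1 (hK π h)).1
      simp only; linarith
    have a := homExt_le _ _ _ h1 u hu
    have b := homExt_le _ _ _ h1 v hv
    have c := homExt_le _ _ _ h2 (u + v) (fun i => add_nonneg (hu i) (hv i))
    have hz : ∀ w : Fin X → ℝ, homExt (fun _ => (0:ℝ)) w = 0 := fun w => by simp [homExt]
    rw [hz] at a b c
    simp only [Pi.add_apply, Finset.sum_add_distrib] at c
    rw [pow_zero]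
    linarith
  | succ n ih =>
    intro u v hu hv
    have huv : ∀ i, 0 ≤ (u + v) i := fun i => add_nonneg (hu i) (hv i)
    have hsum := Finset.sum_le_sum fun y (_ : y ∈ (Finset.univ : Finset (Fin Y))) =>
      ih _ _ (updY_nonneg B P hP hB u hu y) (updY_nonneg B P hP hB v hv y)
    simp only [← updY_add, Finset.sum_add_distrib, ← Finset.mul_sum,
      sum_updY B P hP hB] at hsum
    have hm := mul_le_mul_of_nonneg_left hsum hρ0
    have hC : ∑ i, C i * (u + v) i = (∑ i, C i * u i) + ∑ i, C i * v i := by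
      simp [mul_add, Finset.sum_add_distrib]
    have hK0 : 0 ≤ ρ ^ (n+1) * (2 * K * ((∑ i, u i) + ∑ i, v i)) := by
      rcases (Finset.sum_nonneg fun i _ => huv i : 0 ≤ ∑ j, (u + v) j).eq_or_lt with h0 | h0
      · simp only [Pi.add_apply, Finset.sum_add_distrib] at h0
        rw [← h0]; simp
      · have hK' := (abs_nonneg _).trans (hK _ (probVec_normalize _ huv h0))
        simp only [Pi.add_apply, Finset.sum_add_distrib] at h0
        positivity
    rw [homExt_fix C ρ P B W hW u hu, homExt_fix C ρ P B W hW v hv,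
      homExt_fix C ρ P B W hW _ huv, hC]
    rw [pow_succ] at hK0 ⊢
    set a := (∑ i, C i * u i) + ρ * ∑ y, homExt W (updY B P u y) with ha
    set b := (∑ i, C i * v i) + ρ * ∑ y, homExt W (updY B P v y) with hb
    have h1 := min_le_left 0 a
    have h2 := min_le_left 0 b
    have h3 := min_le_right 0 a
    have h4 := min_le_right 0 b
    rw [← sub_le_iff_le_add]
    refine le_min (by linarith) ?_
    linarith

lemma superadd {X Y : ℕ} (C : Fin X → ℝ) (ρ : ℝ) (hρ0 : 0 ≤ ρ) (hρ1 : ρ < 1)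
    (P : Matrix (Fin X) (Fin X) ℝ) (B : Matrix (Fin X) (Fin Y) ℝ)
    (hP : rowStochastic P) (hB : rowStochastic B)
    (W : (Fin X → ℝ) → ℝ) (hWB : boundedOnSimplex W)
    (hW : ∀ π : Fin X → ℝ, isProbVec π → W π = bellman0 C ρ P B W π)
    (u v : Fin X → ℝ) (hu : ∀ i, 0 ≤ u i) (hv : ∀ i, 0 ≤ v i) :
    homExt W u + homExt W v ≤ homExt W (u + v) := by
  obtain ⟨K, hK⟩ := hWB
  have ht : Filter.Tendsto (fun n : ℕ => homExt W (u + v)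
      + ρ ^ n * (2 * K * ((∑ i, u i) + ∑ i, v i))) Filter.atTop
      (nhds (homExt W (u + v) + 0 * (2 * K * ((∑ i, u i) + ∑ i, v i)))) :=
    ((tendsto_pow_atTop_nhds_zero_of_lt_one hρ0 hρ1).mul_const _).const_add _
  rw [zero_mul, add_zero] at ht
  exact ge_of_tendsto' ht fun n => superadd_approx C ρ hρ0 P B hP hB W K hK hW n u v hu hv

lemma superadd_sum {X : ℕ} {ι : Type*} (W : (Fin X → ℝ) → ℝ)
    (h : ∀ u v : Fin X → ℝ, (∀ i, 0 ≤ u i) → (∀ i, 0 ≤ v i) →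
      homExt W u + homExt W v ≤ homExt W (u + v))
    (s : Finset ι) (f : ι → Fin X → ℝ) (hf : ∀ y i, 0 ≤ f y i) :
    ∑ y ∈ s, homExt W (f y) ≤ homExt W (∑ y ∈ s, f y) := by
  classical
  induction s using Finset.induction_on with
  | empty => simp [homExt]
  | insert a s ha ih =>
    rw [Finset.sum_insert ha, Finset.sum_insert ha]
    refine le_trans (by linarith) (h _ _ (hf a) fun i => ?_)
    rw [Finset.sum_apply]
    exact Finset.sum_nonneg fun y _ => hf y i

/-- Unnormalised social learning update. -/
noncomputable def updA {X Y : ℕ} (B : Matrix (Fin X) (Fin Y) ℝ) (P : Matrix (Fin X) (Fin X) ℝ)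
    (g u : Fin X → ℝ) (a : Fin 2) : Fin X → ℝ :=
  fun i => Rdec B P g u i a * predict P u i

lemma updA_eq {X Y : ℕ} (B : Matrix (Fin X) (Fin Y) ℝ) (P : Matrix (Fin X) (Fin X) ℝ)
    (g u : Fin X → ℝ) (a : Fin 2) :
    updA B P g u a = ∑ y ∈ Finset.univ.filter (fun y => astar B P g u y = a), updY B P u y := by
  funext i
  rw [Finset.sum_apply, Finset.sum_filter]
  unfold updA Rdec Mdec updY
  rw [Finset.sum_mul]
  refine Finset.sum_congr rfl fun y _ => ?_
  by_cases h : astar B P g u y = a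
  · simp [h]
  · simp [h, Ne.symm h]

lemma updA_nonneg {X Y : ℕ} (B : Matrix (Fin X) (Fin Y) ℝ) (P : Matrix (Fin X) (Fin X) ℝ)
    (hP : rowStochastic P) (hB : rowStochastic B) (g u : Fin X → ℝ) (hu : ∀ i, 0 ≤ u i)
    (a : Fin 2) (i : Fin X) : 0 ≤ updA B P g u a i := by
  rw [updA_eq, Finset.sum_apply]
  exact Finset.sum_nonneg fun y _ => updY_nonneg B P hP hB u hu y i

lemma sum_updA {X Y : ℕ} (B : Matrix (Fin X) (Fin Y) ℝ) (P : Matrix (Fin X) (Fin X) ℝ)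
    (hP : rowStochastic P) (hB : rowStochastic B) (g u : Fin X → ℝ) :
    ∑ a, ∑ i, updA B P g u a i = ∑ i, u i := by
  rw [← sum_updY B P hP hB u, ← Finset.sum_fiberwise Finset.univ (fun y => astar B P g u y)]
  refine Finset.sum_congr rfl fun a _ => ?_
  rw [updA_eq]
  simp only [Finset.sum_apply]
  exact Finset.sum_comm

lemma bellman1_eq {X Y : ℕ} (C : Fin X → ℝ) (ρ : ℝ)
    (P : Matrix (Fin X) (Fin X) ℝ) (B : Matrix (Fin X) (Fin Y) ℝ)
    (hP : rowStochastic P) (hB : rowStochastic B) (g : Fin X → ℝ)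
    (W : (Fin X → ℝ) → ℝ) (π : Fin X → ℝ) (hπ : ∀ i, 0 ≤ π i) :
    bellman1 C ρ P B g W π
      = min 0 ((∑ i, C i * π i) + ρ * ∑ a, homExt W (updA B P g π a)) := by
  unfold bellman1
  rw [Finset.sum_filter]
  congr 3
  refine Finset.sum_congr rfl fun a _ => ?_
  split_ifs with h
  · rfl
  · refine (homExt_zero _ _ (le_antisymm (not_lt.1 h) ?_)).symm
    exact Finset.sum_nonneg fun i _ => updA_nonneg B P hP hB g π hπ a i

/-- quickest detection with social learning is always at least as
expensive as classical quickest detection: if `V̲` is the bounded fixed point of the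
classical Bellman operator and `V` the bounded fixed point of the social learning
Bellman operator, then `V̲(π) ≤ V(π)` on the simplex. -/
theorem social_learning_more_expensive {X Y : ℕ}
    (C : Fin X → ℝ) (ρ : ℝ) (hρ0 : 0 ≤ ρ) (hρ1 : ρ < 1)
    (P : Matrix (Fin X) (Fin X) ℝ) (B : Matrix (Fin X) (Fin Y) ℝ)
    (hP : rowStochastic P) (hB : rowStochastic B) (hBpos : ∀ i y, 0 < B i y)
    (c₁ c₂ : Fin X → ℝ)
    (Vlow V : (Fin X → ℝ) → ℝ)
    (hVlowB : boundedOnSimplex Vlow) (hVB : boundedOnSimplex V)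
    (hVlowFix : ∀ π : Fin X → ℝ, isProbVec π → Vlow π = bellman0 C ρ P B Vlow π)
    (hVFix : ∀ π : Fin X → ℝ, isProbVec π →
      V π = bellman1 C ρ P B (fun i => c₁ i - c₂ i) V π) :
    ∀ π : Fin X → ℝ, isProbVec π → Vlow π ≤ V π := by
  intro π₀ hπ₀
  obtain ⟨K, hK⟩ := hVlowB
  obtain ⟨K', hK'⟩ := hVB
  have hsup := superadd C ρ hρ0 hρ1 P B hP hB Vlow ⟨K, hK⟩ hVlowFix
  have key : ∀ n : ℕ, ∀ π : Fin X → ℝ, isProbVec π → Vlow π ≤ V π + ρ ^ n * (K + K') := by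
    intro n
    induction n with
    | zero =>
      intro π h
      have h1 := (abs_le.1 (hK π h)).2
      have h2 := (abs_le.1 (hK' π h)).1
      rw [pow_zero]; linarith
    | succ n ih =>
      intro π h
      have hE : 0 ≤ ρ ^ (n + 1) * (K + K') := by
        have h1 := (abs_nonneg _).trans (hK π h)
        have h2 := (abs_nonneg _).trans (hK' π h)
        positivity
      rw [hVlowFix π h, hVFix π h, bellman0_eq, bellman1_eq C ρ P B hP hB _ V π h.1]
      set g : Fin X → ℝ := fun i => c₁ i - c₂ i
      have s1 : ∑ y, homExt Vlow (updY B P π y) ≤ ∑ a, homExt Vlow (updA B P g π a) := by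
        rw [← Finset.sum_fiberwise Finset.univ (fun y => astar B P g π y)]
        refine Finset.sum_le_sum fun a _ => ?_
        rw [updA_eq]
        exact superadd_sum Vlow hsup _ _ fun y i => updY_nonneg B P hP hB π h.1 y i
      have s2 := Finset.sum_le_sum fun a (_ : a ∈ (Finset.univ : Finset (Fin 2))) =>
        homExt_le Vlow V _ ih _ (updA_nonneg B P hP hB g π h.1 a)
      rw [Finset.sum_add_distrib, ← Finset.mul_sum, sum_updA B P hP hB, h.2] at s2
      have s3 := mul_le_mul_of_nonneg_left (s1.trans s2) hρ0
      rw [pow_succ] at hE ⊢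
      rw [← sub_le_iff_le_add]
      refine le_min ?_ ?_
      · have := min_le_left 0 ((∑ i, C i * π i) + ρ * ∑ y, homExt Vlow (updY B P π y))
        linarith
      · have := min_le_right 0 ((∑ i, C i * π i) + ρ * ∑ y, homExt Vlow (updY B P π y))
        linarith
  have ht : Filter.Tendsto (fun n : ℕ => V π₀ + ρ ^ n * (K + K')) Filter.atTop
      (nhds (V π₀ + 0 * (K + K'))) :=
    ((tendsto_pow_atTop_nhds_zero_of_lt_one hρ0 hρ1).mul_const _).const_add _
  rw [zero_mul, add_zero] at ht
  exact ge_of_tendsto' ht fun n => key n π₀ hπ₀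

end QDSL11
end

section
/- Myopic optimal stopping rule: let ρ ∈ [0,1), C ∈ ℝ^X, and suppose the set S = {π ∈ Π(X) : C′π ≥ 0} is closed under the social learning filter, i.e., for every π ∈ S and every a ∈ {1,2} with σ(π,a) > 0 one has C′ T^π(π,a) ≥ 0. Let V be any bounded function on Π(X) satisfying the fixed-point (Bellman) equation V(π) = min{0, C′π + ρ Σ_{a: σ(π,a)>0} V(T^π(π,a)) σ(π,a)}. Then V(π) = 0 for every π with C′π ≥ 0, and V(π) ≤ C′π < 0 for every π with C′π < 0. Consequently the optimal policy is myopic: it is optimal to stop at π if and only if C′π ≥ 0, so the stopping set equals {π : C′π ≥ 0}. -/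
namespace QDSL12

/-- A probability vector on `Fin n` (element of the belief simplex Π(n)). -/
def isProbVec {n : ℕ} (π : Fin n → ℝ) : Prop :=
  (∀ i, 0 ≤ π i) ∧ ∑ i, π i = 1

/-- Row-stochastic matrix: nonnegative entries, each row sums to one. -/
def rowStochastic {m n : ℕ} (A : Matrix (Fin m) (Fin n) ℝ) : Prop :=
  (∀ i j, 0 ≤ A i j) ∧ ∀ i, ∑ j, A i j = 1

/-- Totally positive of order 2: all second-order minors are nonnegative. -/
def isTP2 {m n : ℕ} (A : Matrix (Fin m) (Fin n) ℝ) : Prop :=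
  ∀ ⦃i i' : Fin m⦄ ⦃j j' : Fin n⦄, i < i' → j < j' → A i j' * A i' j ≤ A i j * A i' j'

/-- `mlrLE q p` means `p ≥_r q` in the monotone likelihood ratio order:
`p i * q j ≤ q i * p j` for all `i < j`. -/
def mlrLE {n : ℕ} (q p : Fin n → ℝ) : Prop :=
  ∀ ⦃i j : Fin n⦄, i < j → p i * q j ≤ q i * p j

/-- Predicted belief `P′π`. -/
def predict {n : ℕ} (P : Matrix (Fin n) (Fin n) ℝ) (π : Fin n → ℝ) : Fin n → ℝ :=
  fun j => ∑ i, P i j * π i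

/-- `g′ B_y P′ π` where `B_y = diag(B_{1y},…,B_{Xy})`. -/
def scoreG {X Y : ℕ} (B : Matrix (Fin X) (Fin Y) ℝ) (P : Matrix (Fin X) (Fin X) ℝ)
    (g π : Fin X → ℝ) (y : Fin Y) : ℝ :=
  ∑ i, g i * B i y * predict P π i

/-- Myopic local decision: `(0 : Fin 2)` codes decision `a = 1` (taken when
`g′B_yP′π ≤ 0`), `(1 : Fin 2)` codes decision `a = 2`. -/
noncomputable def astar {X Y : ℕ} (B : Matrix (Fin X) (Fin Y) ℝ)
    (P : Matrix (Fin X) (Fin X) ℝ) (g π : Fin X → ℝ) (y : Fin Y) : Fin 2 :=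
  if scoreG B P g π y ≤ 0 then 0 else 1

/-- The `Y × 2` local decision matrix `M^π`, with a single `1` per row in column `a*(π,y)`. -/
noncomputable def Mdec {X Y : ℕ} (B : Matrix (Fin X) (Fin Y) ℝ)
    (P : Matrix (Fin X) (Fin X) ℝ) (g π : Fin X → ℝ) :
    Matrix (Fin Y) (Fin 2) ℝ :=
  fun y a => if a = astar B P g π y then 1 else 0

/-- The decision likelihood matrix `R^π = B M^π`. -/
noncomputable def Rdec {X Y : ℕ} (B : Matrix (Fin X) (Fin Y) ℝ)
    (P : Matrix (Fin X) (Fin X) ℝ) (g π : Fin X → ℝ) :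
    Matrix (Fin X) (Fin 2) ℝ :=
  fun i a => ∑ y, B i y * Mdec B P g π y a

/-- `σ(π,a) = 1′ R^π_a P′ π`. -/
noncomputable def sigmaSL {X Y : ℕ} (B : Matrix (Fin X) (Fin Y) ℝ)
    (P : Matrix (Fin X) (Fin X) ℝ) (g π : Fin X → ℝ) (a : Fin 2) : ℝ :=
  ∑ i, Rdec B P g π i a * predict P π i

/-- The social learning Bayesian filter `T^π(π,a) = R^π_a P′π / σ(π,a)`. -/
noncomputable def Tsl {X Y : ℕ} (B : Matrix (Fin X) (Fin Y) ℝ)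
    (P : Matrix (Fin X) (Fin X) ℝ) (g π : Fin X → ℝ) (a : Fin 2) : Fin X → ℝ :=
  fun i => Rdec B P g π i a * predict P π i / sigmaSL B P g π a

/-- `σ(π,y) = 1′ B_y P′ π`. -/
noncomputable def sigmaObs {X Y : ℕ} (B : Matrix (Fin X) (Fin Y) ℝ)
    (P : Matrix (Fin X) (Fin X) ℝ) (π : Fin X → ℝ) (y : Fin Y) : ℝ :=
  ∑ i, B i y * predict P π i

/-- The HMM (classical) filter `T(π,y) = B_y P′π / σ(π,y)`. -/
noncomputable def Thmm {X Y : ℕ} (B : Matrix (Fin X) (Fin Y) ℝ)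
    (P : Matrix (Fin X) (Fin X) ℝ) (π : Fin X → ℝ) (y : Fin Y) : Fin X → ℝ :=
  fun i => B i y * predict P π i / sigmaObs B P π y


/-- Bounded on the belief simplex. -/
def boundedOnSimplex {n : ℕ} (W : (Fin n → ℝ) → ℝ) : Prop :=
  ∃ K : ℝ, ∀ π : Fin n → ℝ, isProbVec π → |W π| ≤ K

theorem predict_nonneg {n : ℕ} {P : Matrix (Fin n) (Fin n) ℝ} (hP : rowStochastic P)
    {π : Fin n → ℝ} (hπ : isProbVec π) (j : Fin n) : 0 ≤ predict P π j :=
  Finset.sum_nonneg fun i _ => mul_nonneg (hP.1 i j) (hπ.1 i)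

theorem predict_sum {n : ℕ} {P : Matrix (Fin n) (Fin n) ℝ} (hP : rowStochastic P)
    {π : Fin n → ℝ} (hπ : isProbVec π) : ∑ j, predict P π j = 1 := by
  unfold predict
  rw [Finset.sum_comm]
  simp_rw [← Finset.sum_mul, hP.2, one_mul]
  exact hπ.2

theorem Rdec_nonneg {X Y : ℕ} {B : Matrix (Fin X) (Fin Y) ℝ} (hB : rowStochastic B)
    (P : Matrix (Fin X) (Fin X) ℝ) (g π : Fin X → ℝ) (i : Fin X) (a : Fin 2) :
    0 ≤ Rdec B P g π i a := by
  refine Finset.sum_nonneg fun y _ => mul_nonneg (hB.1 i y) ?_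
  unfold Mdec
  split_ifs <;> norm_num

theorem Rdec_sum {X Y : ℕ} {B : Matrix (Fin X) (Fin Y) ℝ} (hB : rowStochastic B)
    (P : Matrix (Fin X) (Fin X) ℝ) (g π : Fin X → ℝ) (i : Fin X) :
    ∑ a, Rdec B P g π i a = 1 := by
  unfold Rdec Mdec
  rw [Finset.sum_comm]
  simp_rw [← Finset.mul_sum]
  simpa using hB.2 i

theorem sigma_nonneg {X Y : ℕ} {B : Matrix (Fin X) (Fin Y) ℝ} (hB : rowStochastic B)
    {P : Matrix (Fin X) (Fin X) ℝ} (hP : rowStochastic P) (g : Fin X → ℝ) {π : Fin X → ℝ}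
    (hπ : isProbVec π) (a : Fin 2) : 0 ≤ sigmaSL B P g π a :=
  Finset.sum_nonneg fun i _ => mul_nonneg (Rdec_nonneg hB P g π i a) (predict_nonneg hP hπ i)

theorem sigma_sum {X Y : ℕ} {B : Matrix (Fin X) (Fin Y) ℝ} (hB : rowStochastic B)
    {P : Matrix (Fin X) (Fin X) ℝ} (hP : rowStochastic P) (g : Fin X → ℝ) {π : Fin X → ℝ}
    (hπ : isProbVec π) : ∑ a, sigmaSL B P g π a = 1 := by
  unfold sigmaSL
  rw [Finset.sum_comm]
  simp_rw [← Finset.sum_mul, Rdec_sum hB, one_mul]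
  exact predict_sum hP hπ

theorem Tsl_prob {X Y : ℕ} {B : Matrix (Fin X) (Fin Y) ℝ} (hB : rowStochastic B)
    {P : Matrix (Fin X) (Fin X) ℝ} (hP : rowStochastic P) (g : Fin X → ℝ) {π : Fin X → ℝ}
    (hπ : isProbVec π) (a : Fin 2) (h : 0 < sigmaSL B P g π a) :
    isProbVec (Tsl B P g π a) := by
  refine ⟨fun i => div_nonneg
    (mul_nonneg (Rdec_nonneg hB P g π i a) (predict_nonneg hP hπ i)) h.le, ?_⟩
  unfold Tsl
  rw [← Finset.sum_div]
  exact div_self (ne_of_gt h)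

/-- myopic optimal stopping rule: if the set `S = {π : C′π ≥ 0}` is
closed under the social learning filter, then any bounded solution `V` of the Bellman
equation vanishes on `S` and satisfies `V(π) ≤ C′π < 0` off `S`; consequently it is
optimal to stop at `π` if and only if `C′π ≥ 0`. -/
theorem myopic_stopping_rule {X Y : ℕ}
    (C : Fin X → ℝ) (ρ : ℝ) (hρ0 : 0 ≤ ρ) (hρ1 : ρ < 1)
    (P : Matrix (Fin X) (Fin X) ℝ) (B : Matrix (Fin X) (Fin Y) ℝ)
    (hP : rowStochastic P) (hB : rowStochastic B)
    (c₁ c₂ : Fin X → ℝ)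
    (hclosed : ∀ π : Fin X → ℝ, isProbVec π → 0 ≤ ∑ i, C i * π i →
      ∀ a : Fin 2, 0 < sigmaSL B P (fun i => c₁ i - c₂ i) π a →
        0 ≤ ∑ i, C i * Tsl B P (fun i => c₁ i - c₂ i) π a i)
    (V : (Fin X → ℝ) → ℝ) (hVB : boundedOnSimplex V)
    (hVFix : ∀ π : Fin X → ℝ, isProbVec π →
      V π = min 0 ((∑ i, C i * π i) +
        ρ * ∑ a ∈ Finset.univ.filter
            (fun a => 0 < sigmaSL B P (fun i => c₁ i - c₂ i) π a),
          V (Tsl B P (fun i => c₁ i - c₂ i) π a) *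
            sigmaSL B P (fun i => c₁ i - c₂ i) π a)) :
    ∀ π : Fin X → ℝ, isProbVec π →
      (0 ≤ ∑ i, C i * π i → V π = 0) ∧
      ((∑ i, C i * π i) < 0 → V π ≤ ∑ i, C i * π i) ∧
      ((0 ≤ (∑ i, C i * π i) +
          ρ * ∑ a ∈ Finset.univ.filter
              (fun a => 0 < sigmaSL B P (fun i => c₁ i - c₂ i) π a),
            V (Tsl B P (fun i => c₁ i - c₂ i) π a) *
              sigmaSL B P (fun i => c₁ i - c₂ i) π a) ↔
        0 ≤ ∑ i, C i * π i) := by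
  generalize (fun i => c₁ i - c₂ i) = g at *
  obtain ⟨K, hK⟩ := hVB
  have hV0 : ∀ π, isProbVec π → V π ≤ 0 := fun π hπ => by
    rw [hVFix π hπ]; exact min_le_left _ _
  have key : ∀ n : ℕ, ∀ π, isProbVec π → 0 ≤ ∑ i, C i * π i → -(ρ ^ n * |K|) ≤ V π := by
    intro n
    induction n with
    | zero =>
      intro π hπ _
      have h1 := (abs_le.1 (hK π hπ)).1
      have h2 := le_abs_self K
      simp only [pow_zero, one_mul]
      linarith
    | succ n ih =>
      intro π hπ hC
      have hD : 0 ≤ ρ ^ n * |K| := by positivity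
      rw [hVFix π hπ]
      refine le_min ?_ ?_
      · have : 0 ≤ ρ ^ (n + 1) * |K| := by positivity
        linarith
      · have h1 : ∑ a ∈ Finset.univ.filter (fun a => 0 < sigmaSL B P g π a),
            (-(ρ ^ n * |K|)) * sigmaSL B P g π a ≤
            ∑ a ∈ Finset.univ.filter (fun a => 0 < sigmaSL B P g π a),
              V (Tsl B P g π a) * sigmaSL B P g π a := by
          refine Finset.sum_le_sum fun a ha => ?_
          have ha' := (Finset.mem_filter.1 ha).2
          exact mul_le_mul_of_nonneg_right
            (ih _ (Tsl_prob hB hP g hπ a ha') (hclosed π hπ hC a ha')) ha'.le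
        rw [← Finset.mul_sum] at h1
        have h2 : ∑ a ∈ Finset.univ.filter (fun a => 0 < sigmaSL B P g π a),
            sigmaSL B P g π a ≤ 1 := by
          rw [← sigma_sum hB hP g hπ]
          exact Finset.sum_le_sum_of_subset_of_nonneg (Finset.filter_subset _ _)
            fun a _ _ => sigma_nonneg hB hP g hπ a
        have h3 := mul_le_mul_of_nonneg_left h2 hD
        have h4 : -(ρ ^ n * |K|) ≤
            ∑ a ∈ Finset.univ.filter (fun a => 0 < sigmaSL B P g π a),
              V (Tsl B P g π a) * sigmaSL B P g π a := by linarith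
        have h5 := mul_le_mul_of_nonneg_left h4 hρ0
        have h6 : ρ ^ (n + 1) * |K| = ρ * (ρ ^ n * |K|) := by ring
        linarith
  have hS : ∀ π, isProbVec π → 0 ≤ ∑ i, C i * π i → V π = 0 := by
    intro π hπ hC
    refine le_antisymm (hV0 π hπ) ?_
    have ht : Filter.Tendsto (fun n : ℕ => -(ρ ^ n * |K|)) Filter.atTop (nhds 0) := by
      simpa using ((tendsto_pow_atTop_nhds_zero_of_lt_one hρ0 hρ1).mul_const |K|).neg
    exact le_of_tendsto' ht fun n => key n π hπ hC
  intro π hπ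
  have hF := hVFix π hπ
  have hsum : ρ * ∑ a ∈ Finset.univ.filter (fun a => 0 < sigmaSL B P g π a),
      V (Tsl B P g π a) * sigmaSL B P g π a ≤ 0 := by
    refine mul_nonpos_of_nonneg_of_nonpos hρ0 (Finset.sum_nonpos fun a ha => ?_)
    have ha' := (Finset.mem_filter.1 ha).2
    exact mul_nonpos_of_nonpos_of_nonneg (hV0 _ (Tsl_prob hB hP g hπ a ha')) ha'.le
  refine ⟨hS π hπ, fun _ => ?_, fun h => by linarith, fun h => ?_⟩
  · rw [hF]
    exact (min_le_right _ _).trans (by linarith)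
  · rw [hS π hπ h] at hF
    exact min_eq_left_iff.1 hF.symm

end QDSL12
end

section
/- Let C ∈ ℝ^X satisfy C₁ > 0 and C_i ≤ 0 for i = 2,…,X. Then for every π ∈ Π(X) with C′π > 0 there exists π̄ ∈ Π(X) with C′π̄ = 0 and π̄ ≥_r π. (In particular, π̄ can be taken on the line through e₁ and π, extended away from e₁ to its intersection with the hyperplane {C′π = 0}.) -/
namespace QDSL13

/-- A probability vector on `Fin n` (element of the belief simplex Π(n)). -/
def isProbVec {n : ℕ} (π : Fin n → ℝ) : Prop :=
  (∀ i, 0 ≤ π i) ∧ ∑ i, π i = 1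

/-- Row-stochastic matrix: nonnegative entries, each row sums to one. -/
def rowStochastic {m n : ℕ} (A : Matrix (Fin m) (Fin n) ℝ) : Prop :=
  (∀ i j, 0 ≤ A i j) ∧ ∀ i, ∑ j, A i j = 1

/-- Totally positive of order 2: all second-order minors are nonnegative. -/
def isTP2 {m n : ℕ} (A : Matrix (Fin m) (Fin n) ℝ) : Prop :=
  ∀ ⦃i i' : Fin m⦄ ⦃j j' : Fin n⦄, i < i' → j < j' → A i j' * A i' j ≤ A i j * A i' j'

/-- `mlrLE q p` means `p ≥_r q` in the monotone likelihood ratio order: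
`p i * q j ≤ q i * p j` for all `i < j`. -/
def mlrLE {n : ℕ} (q p : Fin n → ℝ) : Prop :=
  ∀ ⦃i j : Fin n⦄, i < j → p i * q j ≤ q i * p j

/-- Predicted belief `P′π`. -/
def predict {n : ℕ} (P : Matrix (Fin n) (Fin n) ℝ) (π : Fin n → ℝ) : Fin n → ℝ :=
  fun j => ∑ i, P i j * π i

/-- `g′ B_y P′ π` where `B_y = diag(B_{1y},…,B_{Xy})`. -/
def scoreG {X Y : ℕ} (B : Matrix (Fin X) (Fin Y) ℝ) (P : Matrix (Fin X) (Fin X) ℝ)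
    (g π : Fin X → ℝ) (y : Fin Y) : ℝ :=
  ∑ i, g i * B i y * predict P π i

/-- Myopic local decision: `(0 : Fin 2)` codes decision `a = 1` (taken when
`g′B_yP′π ≤ 0`), `(1 : Fin 2)` codes decision `a = 2`. -/
noncomputable def astar {X Y : ℕ} (B : Matrix (Fin X) (Fin Y) ℝ)
    (P : Matrix (Fin X) (Fin X) ℝ) (g π : Fin X → ℝ) (y : Fin Y) : Fin 2 :=
  if scoreG B P g π y ≤ 0 then 0 else 1

/-- The `Y × 2` local decision matrix `M^π`, with a single `1` per row in column `a*(π,y)`. -/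
noncomputable def Mdec {X Y : ℕ} (B : Matrix (Fin X) (Fin Y) ℝ)
    (P : Matrix (Fin X) (Fin X) ℝ) (g π : Fin X → ℝ) :
    Matrix (Fin Y) (Fin 2) ℝ :=
  fun y a => if a = astar B P g π y then 1 else 0

/-- The decision likelihood matrix `R^π = B M^π`. -/
noncomputable def Rdec {X Y : ℕ} (B : Matrix (Fin X) (Fin Y) ℝ)
    (P : Matrix (Fin X) (Fin X) ℝ) (g π : Fin X → ℝ) :
    Matrix (Fin X) (Fin 2) ℝ :=
  fun i a => ∑ y, B i y * Mdec B P g π y a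

/-- `σ(π,a) = 1′ R^π_a P′ π`. -/
noncomputable def sigmaSL {X Y : ℕ} (B : Matrix (Fin X) (Fin Y) ℝ)
    (P : Matrix (Fin X) (Fin X) ℝ) (g π : Fin X → ℝ) (a : Fin 2) : ℝ :=
  ∑ i, Rdec B P g π i a * predict P π i

/-- The social learning Bayesian filter `T^π(π,a) = R^π_a P′π / σ(π,a)`. -/
noncomputable def Tsl {X Y : ℕ} (B : Matrix (Fin X) (Fin Y) ℝ)
    (P : Matrix (Fin X) (Fin X) ℝ) (g π : Fin X → ℝ) (a : Fin 2) : Fin X → ℝ :=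
  fun i => Rdec B P g π i a * predict P π i / sigmaSL B P g π a

/-- `σ(π,y) = 1′ B_y P′ π`. -/
noncomputable def sigmaObs {X Y : ℕ} (B : Matrix (Fin X) (Fin Y) ℝ)
    (P : Matrix (Fin X) (Fin X) ℝ) (π : Fin X → ℝ) (y : Fin Y) : ℝ :=
  ∑ i, B i y * predict P π i

/-- The HMM (classical) filter `T(π,y) = B_y P′π / σ(π,y)`. -/
noncomputable def Thmm {X Y : ℕ} (B : Matrix (Fin X) (Fin Y) ℝ)
    (P : Matrix (Fin X) (Fin X) ℝ) (π : Fin X → ℝ) (y : Fin Y) : Fin X → ℝ :=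
  fun i => B i y * predict P π i / sigmaObs B P π y


theorem aux_mlr {n : ℕ} (C π : Fin (n + 1) → ℝ) (hC0 : 0 < C 0)
    (hCi : ∀ i : Fin n, C i.succ ≤ 0) (μ : Fin n → ℝ) (hμ : ∀ i, 0 ≤ μ i)
    (hs : 0 < ∑ i, μ i)
    (h1 : ∀ i j, μ i * π j.succ ≤ π i.succ * μ j)
    (h2 : ∀ j, -(∑ i, C i.succ * μ i) * π j.succ ≤ π 0 * (C 0 * μ j)) :
    ∃ πb : Fin (n + 1) → ℝ, isProbVec πb ∧ (∑ i, C i * πb i) = 0 ∧ mlrLE π πb := by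
  have hc : ∑ i, C i.succ * μ i ≤ 0 :=
    Finset.sum_nonpos fun i _ => mul_nonpos_of_nonpos_of_nonneg (hCi i) (hμ i)
  generalize hcd : ∑ i, C i.succ * μ i = c at *
  generalize hsd : ∑ i, μ i = s at *
  have hD : 0 < C 0 * s - c := by nlinarith [mul_pos hC0 hs]
  generalize hDd : C 0 * s - c = D at *
  refine ⟨Fin.cons (-c / D) (fun i => C 0 * μ i / D), ⟨?_, ?_⟩, ?_, ?_⟩
  · intro i
    refine Fin.cases ?_ (fun i => ?_) i
    · simpa using div_nonneg (neg_nonneg.2 hc) hD.le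
    · simpa using div_nonneg (mul_nonneg hC0.le (hμ i)) hD.le
  · rw [Fin.sum_univ_succ]
    simp only [Fin.cons_zero, Fin.cons_succ]
    rw [← Finset.sum_div, ← Finset.mul_sum, hsd, ← add_div, div_eq_one_iff_eq hD.ne']
    linarith
  · rw [Fin.sum_univ_succ]
    simp only [Fin.cons_zero, Fin.cons_succ]
    have : ∀ i, C i.succ * (C 0 * μ i / D) = (C 0 / D) * (C i.succ * μ i) := fun i => by ring
    simp only [this]
    rw [← Finset.mul_sum, hcd]
    ring
  · intro i j hij
    induction j using Fin.cases with
    | zero => exact absurd hij (Fin.not_lt_zero i)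
    | succ j =>
      induction i using Fin.cases with
      | zero =>
        simp only [Fin.cons_zero, Fin.cons_succ]
        rw [div_mul_eq_mul_div, mul_div_assoc']
        exact div_le_div_of_nonneg_right (h2 j) hD.le
      | succ i =>
        simp only [Fin.cons_succ]
        rw [div_mul_eq_mul_div, mul_div_assoc']
        refine div_le_div_of_nonneg_right ?_ hD.le
        nlinarith [mul_le_mul_of_nonneg_left (h1 i j) hC0.le]

/-- if `C₁ > 0` and `C_i ≤ 0` for `i ≥ 2`, then every belief `π` with
`C′π > 0` is MLR-dominated by some belief `π̄` on the hyperplane `{C′π̄ = 0}`. -/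
theorem exists_mlr_dominating_on_hyperplane {X : ℕ} (hX : 2 ≤ X)
    (C : Fin X → ℝ)
    (hC1 : 0 < C ⟨0, by omega⟩)
    (hCi : ∀ i : Fin X, i ≠ ⟨0, by omega⟩ → C i ≤ 0)
    (π : Fin X → ℝ) (hπ : isProbVec π) (hpos : 0 < ∑ i, C i * π i) :
    ∃ πb : Fin X → ℝ, isProbVec πb ∧ (∑ i, C i * πb i) = 0 ∧ mlrLE π πb := by
  obtain ⟨n, rfl⟩ := Nat.exists_eq_add_of_le' hX
  have hCi' : ∀ i : Fin (n + 1), C i.succ ≤ 0 := fun i => hCi _ (Fin.succ_ne_zero i)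
  have hC0 : 0 < C 0 := hC1
  obtain ⟨hnn, -⟩ := hπ
  rw [Fin.sum_univ_succ] at hpos
  have hs0 : 0 ≤ ∑ i : Fin (n + 1), π i.succ := Finset.sum_nonneg fun i _ => hnn _
  rcases hs0.lt_or_eq with hs | hs
  · refine aux_mlr C π hC0 hCi' (fun i => π i.succ) (fun i => hnn _) hs
      (fun i j => le_refl _) (fun j => ?_)
    nlinarith [mul_nonneg hpos.le (hnn j.succ)]
  · have hz : ∀ i : Fin (n + 1), π i.succ = 0 := fun i =>
      (Finset.sum_eq_zero_iff_of_nonneg (fun i _ => hnn _)).1 hs.symm i (Finset.mem_univ i)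
    refine aux_mlr C π hC0 hCi' (fun _ => 1) (fun i => zero_le_one) ?_ ?_ ?_
    · simp; positivity
    · intro i j; simp [hz]
    · intro j
      rw [hz j]
      simpa using mul_nonneg (hnn 0) hC0.le

end QDSL13
end

section
/- Let P be an X×X row-stochastic TP2 matrix, B an X×Y row-stochastic TP2 matrix with all entries positive, and C ∈ ℝ^X a vector with nonincreasing entries. Then for every π ∈ Π(X), the updated expected cost C′T(π,y) is nonincreasing in the observation y: for y ≤ y′, C′T(π,y′) ≤ C′T(π,y). In particular, to verify C′T(π,y) ≥ 0 for all y ∈ {1,…,Y} it suffices to verify it at the largest observation y = Y. -/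
namespace QDSL14

/-- A probability vector on `Fin n` (element of the belief simplex Π(n)). -/
def isProbVec {n : ℕ} (π : Fin n → ℝ) : Prop :=
  (∀ i, 0 ≤ π i) ∧ ∑ i, π i = 1

/-- Row-stochastic matrix: nonnegative entries, each row sums to one. -/
def rowStochastic {m n : ℕ} (A : Matrix (Fin m) (Fin n) ℝ) : Prop :=
  (∀ i j, 0 ≤ A i j) ∧ ∀ i, ∑ j, A i j = 1

/-- Totally positive of order 2: all second-order minors are nonnegative. -/
def isTP2 {m n : ℕ} (A : Matrix (Fin m) (Fin n) ℝ) : Prop :=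
  ∀ ⦃i i' : Fin m⦄ ⦃j j' : Fin n⦄, i < i' → j < j' → A i j' * A i' j ≤ A i j * A i' j'

/-- `mlrLE q p` means `p ≥_r q` in the monotone likelihood ratio order:
`p i * q j ≤ q i * p j` for all `i < j`. -/
def mlrLE {n : ℕ} (q p : Fin n → ℝ) : Prop :=
  ∀ ⦃i j : Fin n⦄, i < j → p i * q j ≤ q i * p j

/-- Predicted belief `P′π`. -/
def predict {n : ℕ} (P : Matrix (Fin n) (Fin n) ℝ) (π : Fin n → ℝ) : Fin n → ℝ :=
  fun j => ∑ i, P i j * π i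

/-- `g′ B_y P′ π` where `B_y = diag(B_{1y},…,B_{Xy})`. -/
def scoreG {X Y : ℕ} (B : Matrix (Fin X) (Fin Y) ℝ) (P : Matrix (Fin X) (Fin X) ℝ)
    (g π : Fin X → ℝ) (y : Fin Y) : ℝ :=
  ∑ i, g i * B i y * predict P π i

/-- Myopic local decision: `(0 : Fin 2)` codes decision `a = 1` (taken when
`g′B_yP′π ≤ 0`), `(1 : Fin 2)` codes decision `a = 2`. -/
noncomputable def astar {X Y : ℕ} (B : Matrix (Fin X) (Fin Y) ℝ)
    (P : Matrix (Fin X) (Fin X) ℝ) (g π : Fin X → ℝ) (y : Fin Y) : Fin 2 :=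
  if scoreG B P g π y ≤ 0 then 0 else 1

/-- The `Y × 2` local decision matrix `M^π`, with a single `1` per row in column `a*(π,y)`. -/
noncomputable def Mdec {X Y : ℕ} (B : Matrix (Fin X) (Fin Y) ℝ)
    (P : Matrix (Fin X) (Fin X) ℝ) (g π : Fin X → ℝ) :
    Matrix (Fin Y) (Fin 2) ℝ :=
  fun y a => if a = astar B P g π y then 1 else 0

/-- The decision likelihood matrix `R^π = B M^π`. -/
noncomputable def Rdec {X Y : ℕ} (B : Matrix (Fin X) (Fin Y) ℝ)
    (P : Matrix (Fin X) (Fin X) ℝ) (g π : Fin X → ℝ) :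
    Matrix (Fin X) (Fin 2) ℝ :=
  fun i a => ∑ y, B i y * Mdec B P g π y a

/-- `σ(π,a) = 1′ R^π_a P′ π`. -/
noncomputable def sigmaSL {X Y : ℕ} (B : Matrix (Fin X) (Fin Y) ℝ)
    (P : Matrix (Fin X) (Fin X) ℝ) (g π : Fin X → ℝ) (a : Fin 2) : ℝ :=
  ∑ i, Rdec B P g π i a * predict P π i

/-- The social learning Bayesian filter `T^π(π,a) = R^π_a P′π / σ(π,a)`. -/
noncomputable def Tsl {X Y : ℕ} (B : Matrix (Fin X) (Fin Y) ℝ)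
    (P : Matrix (Fin X) (Fin X) ℝ) (g π : Fin X → ℝ) (a : Fin 2) : Fin X → ℝ :=
  fun i => Rdec B P g π i a * predict P π i / sigmaSL B P g π a

/-- `σ(π,y) = 1′ B_y P′ π`. -/
noncomputable def sigmaObs {X Y : ℕ} (B : Matrix (Fin X) (Fin Y) ℝ)
    (P : Matrix (Fin X) (Fin X) ℝ) (π : Fin X → ℝ) (y : Fin Y) : ℝ :=
  ∑ i, B i y * predict P π i

/-- The HMM (classical) filter `T(π,y) = B_y P′π / σ(π,y)`. -/
noncomputable def Thmm {X Y : ℕ} (B : Matrix (Fin X) (Fin Y) ℝ)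
    (P : Matrix (Fin X) (Fin X) ℝ) (π : Fin X → ℝ) (y : Fin Y) : Fin X → ℝ :=
  fun i => B i y * predict P π i / sigmaObs B P π y


/-- Chebyshev-type inequality obtained by symmetrizing the double sum. -/
lemma aux_cheb {n : ℕ} (C b b' p : Fin n → ℝ) (hC : Antitone C) (hp : ∀ i, 0 ≤ p i)
    (h : ∀ i j, i < j → b' i * b j ≤ b i * b' j) :
    (∑ i, C i * (b' i * p i)) * (∑ i, b i * p i) ≤
      (∑ i, C i * (b i * p i)) * (∑ i, b' i * p i) := by
  have h1 : (∑ i, C i * (b i * p i)) * (∑ i, b' i * p i)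
      - (∑ i, C i * (b' i * p i)) * (∑ i, b i * p i)
      = ∑ i, ∑ j, p i * p j * C i * (b i * b' j - b' i * b j) := by
    rw [Finset.sum_mul_sum, Finset.sum_mul_sum, ← Finset.sum_sub_distrib]
    refine Finset.sum_congr rfl fun i _ => ?_
    rw [← Finset.sum_sub_distrib]
    exact Finset.sum_congr rfl fun j _ => by ring
  have h2 : ∑ i, ∑ j, p i * p j * C i * (b i * b' j - b' i * b j)
      = ∑ i, ∑ j, p j * p i * C j * (b j * b' i - b' j * b i) := Finset.sum_comm
  have h3 : 0 ≤ ∑ i, ∑ j, p i * p j * ((C i - C j) * (b i * b' j - b' i * b j)) := by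
    refine Finset.sum_nonneg fun i _ => Finset.sum_nonneg fun j _ => ?_
    refine mul_nonneg (mul_nonneg (hp i) (hp j)) ?_
    rcases lt_trichotomy i j with hij | hij | hij
    · exact mul_nonneg (sub_nonneg.2 (hC hij.le)) (sub_nonneg.2 (h i j hij))
    · subst hij; simp
    · refine mul_nonneg_of_nonpos_of_nonpos (sub_nonpos.2 (hC hij.le)) ?_
      have := h j i hij
      linarith
  have h4 : ∑ i, ∑ j, p i * p j * ((C i - C j) * (b i * b' j - b' i * b j))
      = (∑ i, ∑ j, p i * p j * C i * (b i * b' j - b' i * b j))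
      + ∑ i, ∑ j, p j * p i * C j * (b j * b' i - b' j * b i) := by
    rw [← Finset.sum_add_distrib]
    refine Finset.sum_congr rfl fun i _ => ?_
    rw [← Finset.sum_add_distrib]
    exact Finset.sum_congr rfl fun j _ => by ring
  linarith

/-- under (A1), (A2) and `C` nonincreasing, the updated expected cost
`C′T(π,y)` is nonincreasing in the observation `y`; in particular it suffices to
verify `C′T(π,y) ≥ 0` at the largest observation. -/
theorem cost_after_update_antitone_in_y {X Y : ℕ} (hY : 0 < Y)
    (P : Matrix (Fin X) (Fin X) ℝ) (B : Matrix (Fin X) (Fin Y) ℝ)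
    (hP : rowStochastic P) (hPtp2 : isTP2 P)
    (hB : rowStochastic B) (hBtp2 : isTP2 B) (hBpos : ∀ i y, 0 < B i y)
    (C : Fin X → ℝ) (hC : Antitone C)
    (π : Fin X → ℝ) (hπ : isProbVec π) :
    (∀ y y' : Fin Y, y ≤ y' →
      (∑ i, C i * Thmm B P π y' i) ≤ ∑ i, C i * Thmm B P π y i) ∧
    ((0 ≤ ∑ i, C i * Thmm B P π ⟨Y - 1, by omega⟩ i) →
      ∀ y : Fin Y, 0 ≤ ∑ i, C i * Thmm B P π y i) := by
  have hp : ∀ i, 0 ≤ predict P π i := fun i =>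
    Finset.sum_nonneg fun j _ => mul_nonneg (hP.1 j i) (hπ.1 j)
  have hps : ∑ i, predict P π i = 1 := by
    unfold predict
    rw [Finset.sum_comm]
    simp_rw [← Finset.sum_mul, hP.2, one_mul]
    exact hπ.2
  have hσ : ∀ y, 0 < sigmaObs B P π y := by
    intro y
    have hex : ∃ i ∈ Finset.univ, 0 < predict P π i := by
      apply Finset.exists_lt_of_sum_lt
      simp [hps]
    obtain ⟨i, hi, hi'⟩ := hex
    exact Finset.sum_pos' (fun j _ => mul_nonneg (hBpos j y).le (hp j))
      ⟨i, hi, mul_pos (hBpos i y) hi'⟩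
  have hT : ∀ y, ∑ i, C i * Thmm B P π y i
      = (∑ i, C i * (B i y * predict P π i)) / sigmaObs B P π y := by
    intro y
    rw [Finset.sum_div]
    exact Finset.sum_congr rfl fun i _ => (mul_div_assoc _ _ _).symm
  have main : ∀ y y' : Fin Y, y ≤ y' →
      (∑ i, C i * Thmm B P π y' i) ≤ ∑ i, C i * Thmm B P π y i := by
    intro y y' hy
    rcases hy.eq_or_lt with rfl | hy
    · exact le_rfl
    rw [hT, hT, div_le_div_iff₀ (hσ y') (hσ y)]
    exact aux_cheb C (fun i => B i y) (fun i => B i y') _ hC hp fun i j hij => hBtp2 hij hy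
  refine ⟨main, fun h y => h.trans (main y _ ?_)⟩
  rw [Fin.le_def]
  have := y.2
  simp only
  omega

end QDSL14
end

section
/- Fixed points of the social learning filter for binary state, observation and decision: let X = Y = A = 2, P = I, let B be a 2×2 row-stochastic TP2 matrix with positive entries, and let g = c₁ − c₂ satisfy g(1) < 0 < g(2). For y ∈ {1,2} let η_y ∈ Π(2) be the unique belief with g′B_yη_y = 0, and define the filter on the informative region by T(π,a) = B_aπ/(1′B_aπ) where B_a = diag(B_{1a},B_{2a}). Then: (i) T(η₁,1) = T(η₂,2) =: q, and q satisfies q(2)/q(1) = −g(1)/g(2); (ii) if in addition B is symmetric (B₁₁ = B₂₂), then T(q,2) = η₁ and T(q,1) = η₂, so η₁ and η₂ are fixed points of the composite maps η₁ = T(T(η₁,1),2) and η₂ = T(T(η₂,2),1); moreover η₂ ≤_r q ≤_r η₁. -/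
namespace QDSL18

/-- A probability vector on `Fin n` (element of the belief simplex Π(n)). -/
def isProbVec {n : ℕ} (π : Fin n → ℝ) : Prop :=
  (∀ i, 0 ≤ π i) ∧ ∑ i, π i = 1

/-- Row-stochastic matrix: nonnegative entries, each row sums to one. -/
def rowStochastic {m n : ℕ} (A : Matrix (Fin m) (Fin n) ℝ) : Prop :=
  (∀ i j, 0 ≤ A i j) ∧ ∀ i, ∑ j, A i j = 1

/-- Totally positive of order 2: all second-order minors are nonnegative. -/
def isTP2 {m n : ℕ} (A : Matrix (Fin m) (Fin n) ℝ) : Prop :=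
  ∀ ⦃i i' : Fin m⦄ ⦃j j' : Fin n⦄, i < i' → j < j' → A i j' * A i' j ≤ A i j * A i' j'

/-- `mlrLE q p` means `p ≥_r q` in the monotone likelihood ratio order:
`p i * q j ≤ q i * p j` for all `i < j`. -/
def mlrLE {n : ℕ} (q p : Fin n → ℝ) : Prop :=
  ∀ ⦃i j : Fin n⦄, i < j → p i * q j ≤ q i * p j

/-- Predicted belief `P′π`. -/
def predict {n : ℕ} (P : Matrix (Fin n) (Fin n) ℝ) (π : Fin n → ℝ) : Fin n → ℝ :=
  fun j => ∑ i, P i j * π i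

/-- `g′ B_y P′ π` where `B_y = diag(B_{1y},…,B_{Xy})`. -/
def scoreG {X Y : ℕ} (B : Matrix (Fin X) (Fin Y) ℝ) (P : Matrix (Fin X) (Fin X) ℝ)
    (g π : Fin X → ℝ) (y : Fin Y) : ℝ :=
  ∑ i, g i * B i y * predict P π i

/-- Myopic local decision: `(0 : Fin 2)` codes decision `a = 1` (taken when
`g′B_yP′π ≤ 0`), `(1 : Fin 2)` codes decision `a = 2`. -/
noncomputable def astar {X Y : ℕ} (B : Matrix (Fin X) (Fin Y) ℝ)
    (P : Matrix (Fin X) (Fin X) ℝ) (g π : Fin X → ℝ) (y : Fin Y) : Fin 2 :=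
  if scoreG B P g π y ≤ 0 then 0 else 1

/-- The `Y × 2` local decision matrix `M^π`, with a single `1` per row in column `a*(π,y)`. -/
noncomputable def Mdec {X Y : ℕ} (B : Matrix (Fin X) (Fin Y) ℝ)
    (P : Matrix (Fin X) (Fin X) ℝ) (g π : Fin X → ℝ) :
    Matrix (Fin Y) (Fin 2) ℝ :=
  fun y a => if a = astar B P g π y then 1 else 0

/-- The decision likelihood matrix `R^π = B M^π`. -/
noncomputable def Rdec {X Y : ℕ} (B : Matrix (Fin X) (Fin Y) ℝ)
    (P : Matrix (Fin X) (Fin X) ℝ) (g π : Fin X → ℝ) :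
    Matrix (Fin X) (Fin 2) ℝ :=
  fun i a => ∑ y, B i y * Mdec B P g π y a

/-- `σ(π,a) = 1′ R^π_a P′ π`. -/
noncomputable def sigmaSL {X Y : ℕ} (B : Matrix (Fin X) (Fin Y) ℝ)
    (P : Matrix (Fin X) (Fin X) ℝ) (g π : Fin X → ℝ) (a : Fin 2) : ℝ :=
  ∑ i, Rdec B P g π i a * predict P π i

/-- The social learning Bayesian filter `T^π(π,a) = R^π_a P′π / σ(π,a)`. -/
noncomputable def Tsl {X Y : ℕ} (B : Matrix (Fin X) (Fin Y) ℝ)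
    (P : Matrix (Fin X) (Fin X) ℝ) (g π : Fin X → ℝ) (a : Fin 2) : Fin X → ℝ :=
  fun i => Rdec B P g π i a * predict P π i / sigmaSL B P g π a

/-- `σ(π,y) = 1′ B_y P′ π`. -/
noncomputable def sigmaObs {X Y : ℕ} (B : Matrix (Fin X) (Fin Y) ℝ)
    (P : Matrix (Fin X) (Fin X) ℝ) (π : Fin X → ℝ) (y : Fin Y) : ℝ :=
  ∑ i, B i y * predict P π i

/-- The HMM (classical) filter `T(π,y) = B_y P′π / σ(π,y)`. -/
noncomputable def Thmm {X Y : ℕ} (B : Matrix (Fin X) (Fin Y) ℝ)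
    (P : Matrix (Fin X) (Fin X) ℝ) (π : Fin X → ℝ) (y : Fin Y) : Fin X → ℝ :=
  fun i => B i y * predict P π i / sigmaObs B P π y


/-- The public belief update on the informative region: `T(π,a) = B_a π / (1′B_a π)`
(here `P = I`, and `a : Fin 2` codes the local decision, `0 ↔ a=1`, `1 ↔ a=2`). -/
noncomputable def Tf (B : Matrix (Fin 2) (Fin 2) ℝ) (π : Fin 2 → ℝ) (a : Fin 2) :
    Fin 2 → ℝ :=
  fun i => B i a * π i / ∑ j, B j a * π j

theorem tf_eq_aux (B : Matrix (Fin 2) (Fin 2) ℝ) (π v : Fin 2 → ℝ) (a : Fin 2)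
    (hs : B 0 a * π 0 + B 1 a * π 1 ≠ 0) (hv : v 0 + v 1 = 1)
    (h : B 0 a * π 0 * v 1 = B 1 a * π 1 * v 0) : Tf B π a = v := by
  funext i
  unfold Tf
  rw [Fin.sum_univ_two, div_eq_iff hs]
  have hv1 : v 1 = 1 - v 0 := by linarith
  rw [hv1] at h
  fin_cases i
  · simp only [Fin.zero_eta]
    linarith
  · simp only [Fin.mk_one, hv1]
    linarith

/-- fixed points of the social learning filter for binary state,
observation and decision: (i) `T(η₁,1) = T(η₂,2) =: q` and `q(2)/q(1) = −g(1)/g(2)`;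
(ii) if `B` is symmetric then `T(q,2) = η₁`, `T(q,1) = η₂`, so `η₁, η₂` are fixed
points of the composite maps, and `η₂ ≤_r q ≤_r η₁`. -/
theorem binary_filter_fixed_points
    (B : Matrix (Fin 2) (Fin 2) ℝ) (hB : rowStochastic B)
    (hBpos : ∀ i y, 0 < B i y) (hBtp2 : isTP2 B)
    (g : Fin 2 → ℝ) (hg0 : g 0 < 0) (hg1 : 0 < g 1)
    (η₁ η₂ : Fin 2 → ℝ) (hη₁ : isProbVec η₁) (hη₂ : isProbVec η₂)
    (hdef₁ : g 0 * B 0 0 * η₁ 0 + g 1 * B 1 0 * η₁ 1 = 0)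
    (hdef₂ : g 0 * B 0 1 * η₂ 0 + g 1 * B 1 1 * η₂ 1 = 0) :
    Tf B η₁ 0 = Tf B η₂ 1 ∧
    (Tf B η₁ 0) 1 / (Tf B η₁ 0) 0 = -(g 0) / g 1 ∧
    (B 0 0 = B 1 1 →
      Tf B (Tf B η₁ 0) 1 = η₁ ∧
      Tf B (Tf B η₁ 0) 0 = η₂ ∧
      η₁ = Tf B (Tf B η₁ 0) 1 ∧
      η₂ = Tf B (Tf B η₂ 1) 0 ∧
      mlrLE η₂ (Tf B η₁ 0) ∧ mlrLE (Tf B η₁ 0) η₁) := by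
  have h00 := hBpos 0 0
  have h01 := hBpos 0 1
  have h10 := hBpos 1 0
  have h11 := hBpos 1 1
  obtain ⟨hn1, hs1⟩ := hη₁
  obtain ⟨hn2, hs2⟩ := hη₂
  rw [Fin.sum_univ_two] at hs1 hs2
  have r0 := hB.2 0
  have r1 := hB.2 1
  rw [Fin.sum_univ_two] at r0 r1
  have tp := hBtp2 (show (0 : Fin 2) < 1 by decide) (show (0 : Fin 2) < 1 by decide)
  have hd : 0 < g 1 - g 0 := by linarith
  have pos : ∀ (π : Fin 2 → ℝ) (a : Fin 2), (∀ i, 0 ≤ π i) → π 0 + π 1 = 1 →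
      B 0 a * π 0 + B 1 a * π 1 ≠ 0 := by
    intro π a hn hs
    have e0 := hBpos 0 a
    have e1 := hBpos 1 a
    have p0 := hn 0
    have p1 := hn 1
    apply ne_of_gt
    rcases p0.lt_or_eq with h | h
    · have := mul_pos e0 h
      have := mul_nonneg e1.le p1
      linarith
    · have : π 1 = 1 := by linarith
      rw [← h, this]
      linarith
  obtain ⟨q, hq⟩ : ∃ q : Fin 2 → ℝ, q = ![g 1 / (g 1 - g 0), -g 0 / (g 1 - g 0)] := ⟨_, rfl⟩
  have hq0 : q 0 = g 1 / (g 1 - g 0) := by simp [hq]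
  have hq1 : q 1 = -g 0 / (g 1 - g 0) := by simp [hq]
  have q0 : 0 < q 0 := by rw [hq0]; positivity
  have q1 : 0 < q 1 := by
    rw [hq1]
    exact div_pos (by linarith) hd
  have hqs : q 0 + q 1 = 1 := by
    rw [hq0, hq1]
    field_simp
    ring
  have hqn : ∀ i, 0 ≤ q i := by
    intro i
    fin_cases i
    · exact q0.le
    · exact q1.le
  have k1 : B 0 0 * η₁ 0 * q 1 = B 1 0 * η₁ 1 * q 0 := by
    rw [hq0, hq1]
    field_simp
    linarith
  have k2 : B 0 1 * η₂ 0 * q 1 = B 1 1 * η₂ 1 * q 0 := by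
    rw [hq0, hq1]
    field_simp
    linarith
  have T1 : Tf B η₁ 0 = q := tf_eq_aux B η₁ q 0 (pos η₁ 0 hn1 hs1) hqs k1
  have T2 : Tf B η₂ 1 = q := tf_eq_aux B η₂ q 1 (pos η₂ 1 hn2 hs2) hqs k2
  rw [T1, T2]
  refine ⟨rfl, ?_, ?_⟩
  · rw [hq0, hq1]
    field_simp
  · intro hsym
    have hsym' : B 0 1 = B 1 0 := by linarith
    have T3 : Tf B q 1 = η₁ := by
      apply tf_eq_aux B q η₁ 1 (pos q 1 hqn hqs) hs1
      rw [hsym', ← hsym]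
      linarith
    have T4 : Tf B q 0 = η₂ := by
      apply tf_eq_aux B q η₂ 0 (pos q 0 hqn hqs) hs2
      rw [← hsym', hsym]
      linarith
    have hle : B 1 0 ≤ B 0 0 := by
      rw [hsym', ← hsym] at tp
      nlinarith
    have a1 := hn1 0
    have a2 := hn2 1
    refine ⟨T3, T4, T3.symm, T4.symm, ?_, ?_⟩
    · intro i j hij
      have hi : i = 0 := by omega
      have hj : j = 1 := by omega
      subst hi hj
      rw [hsym', ← hsym] at k2
      have := mul_le_mul_of_nonneg_right hle (mul_nonneg a2 q0.le)
      have : B 1 0 * (q 0 * η₂ 1) ≤ B 1 0 * (η₂ 0 * q 1) := by linarith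
      exact le_of_mul_le_mul_left this h10
    · intro i j hij
      have hi : i = 0 := by omega
      have hj : j = 1 := by omega
      subst hi hj
      have := mul_le_mul_of_nonneg_right hle (mul_nonneg a1 q1.le)
      have : B 1 0 * (η₁ 0 * q 1) ≤ B 1 0 * (q 0 * η₁ 1) := by linarith
      exact le_of_mul_le_mul_left this h10

end QDSL18
end

section
/- One-step preservation of MLR monotonicity (key step in proving the optimal policy has a single threshold curve): let P be an X×X row-stochastic TP2 matrix and R an X×A nonnegative TP2 matrix whose rows each sum to 1 and each of whose columns is either identically zero or entrywise positive. Define σ(π,a) = 1′R_aP′π and T(π,a) = R_aP′π/σ(π,a), where R_a = diag(R_{1a},…,R_{Xa}). If W : Π(X) → ℝ is MLR-nonincreasing (π₁ ≥_r π₂ implies W(π₁) ≤ W(π₂)), then the function Φ(π) = Σ_{a: σ(π,a)>0} W(T(π,a)) σ(π,a) is MLR-nonincreasing on Π(X): π₁ ≥_r π₂ implies Φ(π₁) ≤ Φ(π₂). -/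
namespace QDSL19

/-- A probability vector on `Fin n` (element of the belief simplex Π(n)). -/
def isProbVec {n : ℕ} (π : Fin n → ℝ) : Prop :=
  (∀ i, 0 ≤ π i) ∧ ∑ i, π i = 1

/-- Row-stochastic matrix: nonnegative entries, each row sums to one. -/
def rowStochastic {m n : ℕ} (A : Matrix (Fin m) (Fin n) ℝ) : Prop :=
  (∀ i j, 0 ≤ A i j) ∧ ∀ i, ∑ j, A i j = 1

/-- Totally positive of order 2: all second-order minors are nonnegative. -/
def isTP2 {m n : ℕ} (A : Matrix (Fin m) (Fin n) ℝ) : Prop :=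
  ∀ ⦃i i' : Fin m⦄ ⦃j j' : Fin n⦄, i < i' → j < j' → A i j' * A i' j ≤ A i j * A i' j'

/-- `mlrLE q p` means `p ≥_r q` in the monotone likelihood ratio order:
`p i * q j ≤ q i * p j` for all `i < j`. -/
def mlrLE {n : ℕ} (q p : Fin n → ℝ) : Prop :=
  ∀ ⦃i j : Fin n⦄, i < j → p i * q j ≤ q i * p j

/-- Predicted belief `P′π`. -/
def predict {n : ℕ} (P : Matrix (Fin n) (Fin n) ℝ) (π : Fin n → ℝ) : Fin n → ℝ :=
  fun j => ∑ i, P i j * π i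

/-- `g′ B_y P′ π` where `B_y = diag(B_{1y},…,B_{Xy})`. -/
def scoreG {X Y : ℕ} (B : Matrix (Fin X) (Fin Y) ℝ) (P : Matrix (Fin X) (Fin X) ℝ)
    (g π : Fin X → ℝ) (y : Fin Y) : ℝ :=
  ∑ i, g i * B i y * predict P π i

/-- Myopic local decision: `(0 : Fin 2)` codes decision `a = 1` (taken when
`g′B_yP′π ≤ 0`), `(1 : Fin 2)` codes decision `a = 2`. -/
noncomputable def astar {X Y : ℕ} (B : Matrix (Fin X) (Fin Y) ℝ)
    (P : Matrix (Fin X) (Fin X) ℝ) (g π : Fin X → ℝ) (y : Fin Y) : Fin 2 :=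
  if scoreG B P g π y ≤ 0 then 0 else 1

/-- The `Y × 2` local decision matrix `M^π`, with a single `1` per row in column `a*(π,y)`. -/
noncomputable def Mdec {X Y : ℕ} (B : Matrix (Fin X) (Fin Y) ℝ)
    (P : Matrix (Fin X) (Fin X) ℝ) (g π : Fin X → ℝ) :
    Matrix (Fin Y) (Fin 2) ℝ :=
  fun y a => if a = astar B P g π y then 1 else 0

/-- The decision likelihood matrix `R^π = B M^π`. -/
noncomputable def Rdec {X Y : ℕ} (B : Matrix (Fin X) (Fin Y) ℝ)
    (P : Matrix (Fin X) (Fin X) ℝ) (g π : Fin X → ℝ) :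
    Matrix (Fin X) (Fin 2) ℝ :=
  fun i a => ∑ y, B i y * Mdec B P g π y a

/-- `σ(π,a) = 1′ R^π_a P′ π`. -/
noncomputable def sigmaSL {X Y : ℕ} (B : Matrix (Fin X) (Fin Y) ℝ)
    (P : Matrix (Fin X) (Fin X) ℝ) (g π : Fin X → ℝ) (a : Fin 2) : ℝ :=
  ∑ i, Rdec B P g π i a * predict P π i

/-- The social learning Bayesian filter `T^π(π,a) = R^π_a P′π / σ(π,a)`. -/
noncomputable def Tsl {X Y : ℕ} (B : Matrix (Fin X) (Fin Y) ℝ)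
    (P : Matrix (Fin X) (Fin X) ℝ) (g π : Fin X → ℝ) (a : Fin 2) : Fin X → ℝ :=
  fun i => Rdec B P g π i a * predict P π i / sigmaSL B P g π a

/-- `σ(π,y) = 1′ B_y P′ π`. -/
noncomputable def sigmaObs {X Y : ℕ} (B : Matrix (Fin X) (Fin Y) ℝ)
    (P : Matrix (Fin X) (Fin X) ℝ) (π : Fin X → ℝ) (y : Fin Y) : ℝ :=
  ∑ i, B i y * predict P π i

/-- The HMM (classical) filter `T(π,y) = B_y P′π / σ(π,y)`. -/
noncomputable def Thmm {X Y : ℕ} (B : Matrix (Fin X) (Fin Y) ℝ)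
    (P : Matrix (Fin X) (Fin X) ℝ) (π : Fin X → ℝ) (y : Fin Y) : Fin X → ℝ :=
  fun i => B i y * predict P π i / sigmaObs B P π y


/-- `σ(π,a) = 1′ R_a P′ π` for a general decision-likelihood matrix `R`. -/
noncomputable def sigmaGen {X A : ℕ} (R : Matrix (Fin X) (Fin A) ℝ)
    (P : Matrix (Fin X) (Fin X) ℝ) (π : Fin X → ℝ) (a : Fin A) : ℝ :=
  ∑ i, R i a * predict P π i

/-- `T(π,a) = R_a P′π / σ(π,a)` for a general decision-likelihood matrix `R`. -/
noncomputable def TGen {X A : ℕ} (R : Matrix (Fin X) (Fin A) ℝ)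
    (P : Matrix (Fin X) (Fin X) ℝ) (π : Fin X → ℝ) (a : Fin A) : Fin X → ℝ :=
  fun i => R i a * predict P π i / sigmaGen R P π a

theorem sum_sum_nonpos_of_pair {n : ℕ} (F : Fin n → Fin n → ℝ)
    (hd : ∀ a, F a a ≤ 0) (h : ∀ a b, a < b → F a b + F b a ≤ 0) :
    ∑ a, ∑ b, F a b ≤ 0 := by
  have h1 : ∑ a, ∑ b, (F a b + F b a) ≤ 0 := by
    refine Finset.sum_nonpos fun a _ => Finset.sum_nonpos fun b _ => ?_
    rcases lt_trichotomy a b with hab | hab | hab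
    · exact h a b hab
    · subst hab; linarith [hd a]
    · linarith [h b a hab]
  have h2 : ∑ a, ∑ b, F b a = ∑ a, ∑ b, F a b := Finset.sum_comm
  simp only [Finset.sum_add_distrib] at h1
  linarith

theorem mlr_push {m n : ℕ} (M : Matrix (Fin m) (Fin n) ℝ) (hM : isTP2 M)
    (p q : Fin m → ℝ) (h : mlrLE q p) :
    mlrLE (fun j => ∑ i, M i j * q i) (fun j => ∑ i, M i j * p i) := by
  intro i j hij
  have key := sum_sum_nonpos_of_pair
    (fun k l => (M k i * p k) * (M l j * q l) - (M k i * q k) * (M l j * p l))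
    (fun a => le_of_eq (by ring))
    (fun k l hkl => by
      have h1 := hM hkl hij
      have h2 := h hkl
      nlinarith [mul_nonneg (sub_nonneg.2 h1) (sub_nonneg.2 h2)])
  simp only [Finset.sum_sub_distrib, ← Finset.sum_mul_sum] at key
  exact sub_nonpos.1 key

theorem predict_probVec {n : ℕ} (P : Matrix (Fin n) (Fin n) ℝ) (hP : rowStochastic P)
    (p : Fin n → ℝ) (hp : isProbVec p) : isProbVec (predict P p) := by
  refine ⟨fun j => Finset.sum_nonneg fun i _ => mul_nonneg (hP.1 i j) (hp.1 i), ?_⟩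
  unfold predict
  rw [Finset.sum_comm]
  simp only [← Finset.sum_mul, hP.2, one_mul, hp.2]

theorem sigma_sum {X A : ℕ} (P : Matrix (Fin X) (Fin X) ℝ) (hP : rowStochastic P)
    (R : Matrix (Fin X) (Fin A) ℝ) (hRrow : ∀ i, ∑ a, R i a = 1)
    (p : Fin X → ℝ) (hp : isProbVec p) : ∑ a, sigmaGen R P p a = 1 := by
  unfold sigmaGen
  rw [Finset.sum_comm]
  simp only [← Finset.sum_mul, hRrow, one_mul, (predict_probVec P hP p hp).2]

theorem sigma_pos {X A : ℕ} (P : Matrix (Fin X) (Fin X) ℝ) (hP : rowStochastic P)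
    (R : Matrix (Fin X) (Fin A) ℝ) (p : Fin X → ℝ) (hp : isProbVec p) (a : Fin A)
    (ha : ∀ i, 0 < R i a) : 0 < sigmaGen R P p a := by
  have hq := predict_probVec P hP p hp
  have hn : ∀ i ∈ Finset.univ, 0 ≤ R i a * predict P p i :=
    fun i _ => mul_nonneg (ha i).le (hq.1 i)
  refine lt_of_le_of_ne (Finset.sum_nonneg hn) fun h0 => ?_
  have h1 := (Finset.sum_eq_zero_iff_of_nonneg hn).1 h0.symm
  have h2 : ∑ i, predict P p i = 0 := Finset.sum_eq_zero fun i hi =>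
    (mul_eq_zero.1 (h1 i hi)).resolve_left (ha i).ne'
  rw [hq.2] at h2
  exact one_ne_zero h2

theorem TGen_probVec {X A : ℕ} (P : Matrix (Fin X) (Fin X) ℝ) (hP : rowStochastic P)
    (R : Matrix (Fin X) (Fin A) ℝ) (p : Fin X → ℝ) (hp : isProbVec p) (a : Fin A)
    (ha : ∀ i, 0 < R i a) : isProbVec (TGen R P p a) := by
  have hq := predict_probVec P hP p hp
  have hs := sigma_pos P hP R p hp a ha
  refine ⟨fun i => div_nonneg (mul_nonneg (ha i).le (hq.1 i)) hs.le, ?_⟩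
  unfold TGen
  rw [← Finset.sum_div]
  exact div_self hs.ne'

theorem mlr_div {n : ℕ} (p q : Fin n → ℝ) (s t : ℝ) (hs : 0 < s) (ht : 0 < t)
    (h : mlrLE q p) : mlrLE (fun i => q i / t) (fun i => p i / s) := by
  intro i j hij
  have h1 := h hij
  have e1 : p i / s * (q j / t) = (p i * q j) / (s * t) := by rw [div_mul_div_comm]
  have e2 : q i / t * (p j / s) = (q i * p j) / (s * t) := by
    rw [div_mul_div_comm, mul_comm t s]
  simp only [e1, e2]
  exact div_le_div_of_nonneg_right h1 (mul_pos hs ht).le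

/-- one-step preservation of MLR monotonicity: for `P` TP2 stochastic
and `R` TP2 with unit row sums and columns either identically zero or entrywise
positive, if `W` is MLR-nonincreasing then
`Φ(π) = Σ_{a : σ(π,a)>0} W(T(π,a)) σ(π,a)` is MLR-nonincreasing on the simplex. -/
theorem one_step_MLR_preservation {X A : ℕ}
    (P : Matrix (Fin X) (Fin X) ℝ) (hP : rowStochastic P) (hPtp2 : isTP2 P)
    (R : Matrix (Fin X) (Fin A) ℝ)
    (hRpos : ∀ i a, 0 ≤ R i a) (hRtp2 : isTP2 R)
    (hRrow : ∀ i, ∑ a, R i a = 1)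
    (hRcol : ∀ a : Fin A, (∀ i, R i a = 0) ∨ (∀ i, 0 < R i a))
    (W : (Fin X → ℝ) → ℝ)
    (hW : ∀ π₁ π₂ : Fin X → ℝ, isProbVec π₁ → isProbVec π₂ →
      mlrLE π₂ π₁ → W π₁ ≤ W π₂) :
    ∀ π₁ π₂ : Fin X → ℝ, isProbVec π₁ → isProbVec π₂ → mlrLE π₂ π₁ →
      (∑ a ∈ Finset.univ.filter (fun a => 0 < sigmaGen R P π₁ a),
          W (TGen R P π₁ a) * sigmaGen R P π₁ a) ≤
        ∑ a ∈ Finset.univ.filter (fun a => 0 < sigmaGen R P π₂ a),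
          W (TGen R P π₂ a) * sigmaGen R P π₂ a := by
  intro π₁ π₂ h₁ h₂ h12
  have hq1 := predict_probVec P hP π₁ h₁
  have hq2 := predict_probVec P hP π₂ h₂
  have hq : mlrLE (predict P π₂) (predict P π₁) := mlr_push P hPtp2 π₁ π₂ h12
  have hσ : mlrLE (sigmaGen R P π₂) (sigmaGen R P π₁) :=
    mlr_push R hRtp2 (predict P π₁) (predict P π₂) hq
  have hnn : ∀ p, isProbVec p → ∀ a, 0 ≤ sigmaGen R P p a := fun p hp a =>
    Finset.sum_nonneg fun i _ => mul_nonneg (hRpos i a) ((predict_probVec P hP p hp).1 i)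
  have hz : ∀ p a, (∀ i, R i a = 0) → sigmaGen R P p a = 0 := fun p a ha => by
    simp [sigmaGen, ha]
  have hfull : ∀ p, isProbVec p →
      (∑ a ∈ Finset.univ.filter (fun a => 0 < sigmaGen R P p a),
          W (TGen R P p a) * sigmaGen R P p a) =
        ∑ a, W (TGen R P p a) * sigmaGen R P p a := fun p hp => by
    refine Finset.sum_subset (Finset.filter_subset _ _) fun a _ ha => ?_
    have : sigmaGen R P p a = 0 := by
      refine le_antisymm ?_ (hnn p hp a)
      simpa using ha
    rw [this, mul_zero]
  rw [hfull π₁ h₁, hfull π₂ h₂]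
  have step1 : ∑ a, W (TGen R P π₁ a) * sigmaGen R P π₁ a ≤
      ∑ a, W (TGen R P π₂ a) * sigmaGen R P π₁ a := by
    refine Finset.sum_le_sum fun a _ => ?_
    rcases hRcol a with ha | ha
    · simp [hz π₁ a ha]
    · refine mul_le_mul_of_nonneg_right ?_ (hnn π₁ h₁ a)
      refine hW _ _ (TGen_probVec P hP R π₁ h₁ a ha) (TGen_probVec P hP R π₂ h₂ a ha) ?_
      refine mlr_div _ _ _ _ (sigma_pos P hP R π₁ h₁ a ha) (sigma_pos P hP R π₂ h₂ a ha) ?_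
      intro i j hij
      have := hq hij
      nlinarith [mul_le_mul_of_nonneg_left this (mul_nonneg (hRpos i a) (hRpos j a))]
  refine step1.trans ?_
  have key := sum_sum_nonpos_of_pair
    (fun a b => (W (TGen R P π₂ a) * sigmaGen R P π₁ a) * sigmaGen R P π₂ b
      - (W (TGen R P π₂ a) * sigmaGen R P π₂ a) * sigmaGen R P π₁ b)
    (fun a => le_of_eq (by ring))
    (fun a b hab => by
      rcases hRcol a with ha | ha
      · simp [hz _ a ha]
      rcases hRcol b with hb | hb
      · simp [hz _ b hb]
      have hw : W (TGen R P π₂ b) ≤ W (TGen R P π₂ a) := by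
        refine hW _ _ (TGen_probVec P hP R π₂ h₂ b hb) (TGen_probVec P hP R π₂ h₂ a ha) ?_
        refine mlr_div _ _ _ _ (sigma_pos P hP R π₂ h₂ b hb)
          (sigma_pos P hP R π₂ h₂ a ha) ?_
        intro i j hij
        have := hRtp2 hij hab
        nlinarith [mul_le_mul_of_nonneg_left this (mul_nonneg (hq2.1 i) (hq2.1 j))]
      have := hσ hab
      nlinarith [mul_nonneg (sub_nonneg.2 hw) (sub_nonneg.2 this)])
  simp only [Finset.sum_sub_distrib, ← Finset.sum_mul_sum,
    sigma_sum P hP R hRrow π₁ h₁, sigma_sum P hP R hRrow π₂ h₂, mul_one] at key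
  exact sub_nonpos.1 key

end QDSL19
end
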